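/- Under Hypothesis H, for every non-negative integer ℓ there exist polynomials in n variables with coefficients in the subfield ℚ({a_{ij}}) of ℂ generated by the entries of M, whose values at w = (w_1,…,w_n) equal ζ_{N,n}(−ℓ, w, M) and 𝒵_{N,n}(−ℓ, w, M) respectively, for every w ∈ ℂ^n with Re(w_j) > 0 for all j. In particular, w ↦ ζ_{N,n}(−ℓ, w, M) and w ↦ 𝒵_{N,n}(−ℓ, w, M) are polynomial functions of w_1,…,w_n. -/

import Mathlib

open MeasureTheory Complex
open scoped Classical

noncomputable section

/-- Hypothesis H: each entry of the matrix either vanishes or has positive real part,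
and no row vanishes. -/
def HypH {N n : ℕ} (a : Fin N → Fin n → ℂ) : Prop :=
  (∀ i j, a i j = 0 ∨ 0 < (a i j).re) ∧ ∀ i, ∃ j, a i j ≠ 0

/-- The Shintani–Barnes zeta series `ζ_{N,n}(s,w,M)`. -/
def zetaSeries {N n : ℕ} (a : Fin N → Fin n → ℂ) (s : ℂ) (w : Fin n → ℂ) : ℂ :=
  ∑' k : Fin N → ℕ, ∏ j, (w j + ∑ i, (k i : ℂ) * a i j) ^ (-s)

/-- The Shintani–Barnes zeta integral `𝒵_{N,n}(s,w,M)`. -/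
def zetaIntegral {N n : ℕ} (a : Fin N → Fin n → ℂ) (s : ℂ) (w : Fin n → ℂ) : ℂ :=
  ∫ t in {t : Fin N → ℝ | ∀ i, 0 < t i}, ∏ j, (w j + ∑ i, (t i : ℂ) * a i j) ^ (-s)

open Filter Topology Metric Set in
/-- A parameter integral of holomorphic functions with an integrable bound is holomorphic. -/
theorem differentiableOn_integral_of_bound {T : Type*} [MeasurableSpace T] {μ : Measure T}
    {W : Set ℂ} (hW : IsOpen W) {f : ℂ → T → ℂ} {B : T → ℝ} (hB : Integrable B μ)
    (hm : ∀ z ∈ W, AEStronglyMeasurable (f z) μ)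
    (hb : ∀ᵐ t ∂μ, ∀ z ∈ W, ‖f z t‖ ≤ B t)
    (hd : ∀ᵐ t ∂μ, DifferentiableOn ℂ (fun z => f z t) W) :
    DifferentiableOn ℂ (fun z => ∫ t, f z t ∂μ) W := by
  intro x hx
  obtain ⟨r, hr, hrW⟩ := Metric.isOpen_iff.1 hW x hx
  have hr2 : 0 < r / 2 := by positivity
  have hsub : ∀ y ∈ ball x (r / 2), closedBall y (r / 4) ⊆ W := by
    intro y hy z hz
    apply hrW
    rw [mem_ball] at hy ⊢
    rw [mem_closedBall] at hz
    have := dist_triangle z y x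
    linarith
  refine (hasDerivAt_integral_of_dominated_loc_of_deriv_le (s := ball x (r / 2))
    (F := f) (F' := fun z t => deriv (fun z => f z t) z) (bound := fun t => B t / (r / 4))
    (ball_mem_nhds x hr2) ?_ ?_ ?_ ?_ (hB.div_const _) ?_).2.differentiableAt.differentiableWithinAt
  · filter_upwards [hW.mem_nhds hx] with z hz using hm z hz
  · exact hB.mono' (hm x hx) (hb.mono fun t ht => ht x hx)
  · have hu : Tendsto (fun k : ℕ => x + ((r / 2 / (k + 1) : ℝ) : ℂ)) atTop (𝓝[≠] x) := by
      rw [tendsto_nhdsWithin_iff]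
      constructor
      · have h1 : Tendsto (fun k : ℕ => (r / 2 / ((k : ℝ) + 1) : ℝ)) atTop (𝓝 0) :=
          tendsto_const_nhds.div_atTop
            (tendsto_atTop_add_const_right _ _ tendsto_natCast_atTop_atTop)
        have h2 := (continuous_ofReal.tendsto 0).comp h1
        simpa using! h2.const_add x
      · refine Eventually.of_forall fun k => ?_
        have : (r / 2 / ((k : ℝ) + 1) : ℝ) ≠ 0 := by positivity
        simp only [mem_compl_iff, mem_singleton_iff, add_eq_left, ofReal_eq_zero]
        exact this
    have hsl : ∀ᶠ k : ℕ in atTop, x + ((r / 2 / (k + 1) : ℝ) : ℂ) ∈ W :=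
      (hu.mono_right nhdsWithin_le_nhds).eventually (hW.mem_nhds hx)
    obtain ⟨K, hK⟩ := eventually_atTop.1 hsl
    refine aestronglyMeasurable_of_tendsto_ae (u := atTop)
      (f := fun (k : ℕ) t =>
        slope (fun z => f z t) x (x + ((r / 2 / (((k + K : ℕ) : ℝ) + 1) : ℝ) : ℂ))) ?_ ?_
    · intro k
      simp only [slope, vsub_eq_sub]
      have h1 := (hm _ (hK (k + K) (by lia))).sub (hm x hx)
      exact h1.const_smul (x + ((r / 2 / (((k + K : ℕ) : ℝ) + 1) : ℝ) : ℂ) - x)⁻¹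
    · filter_upwards [hd] with t ht
      have h := ((ht.differentiableAt (hW.mem_nhds hx)).hasDerivAt).tendsto_slope
      exact (h.comp hu).comp (tendsto_add_atTop_nat K)
  · filter_upwards [hb, hd] with t ht htd y hy
    refine norm_deriv_le_of_forall_mem_sphere_norm_le (by positivity) ?_ ?_
    · exact (htd.mono ((closure_ball_subset_closedBall).trans (hsub y hy))).diffContOnCl
    · exact fun z hz => ht z (hsub y hy (sphere_subset_closedBall hz))
  · filter_upwards [hd] with t ht y hy
    exact (ht.differentiableAt
      (hW.mem_nhds (hsub y hy (mem_closedBall_self (by positivity))))).hasDerivAt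

open Metric in
/-- Cauchy's formula for iterated derivatives as a parameter integral: derivatives of a
holomorphic family are holomorphic in the parameter. -/
theorem differentiableOn_iteratedDeriv_param {W : Set ℂ} (hW : IsOpen W) {f : ℂ → ℂ → ℂ}
    {c : ℂ} {R B : ℝ} (hR : 0 < R) (j : ℕ)
    (hf : ∀ ζ ∈ W, DifferentiableOn ℂ (f ζ) (closedBall c R))
    (hb : ∀ ζ ∈ W, ∀ t ∈ closedBall c R, ‖f ζ t‖ ≤ B)
    (hd : ∀ t ∈ closedBall c R, DifferentiableOn ℂ (fun ζ => f ζ t) W) :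
    DifferentiableOn ℂ (fun ζ => iteratedDeriv j (f ζ) c) W := by
  have key : ∀ ζ ∈ W, iteratedDeriv j (f ζ) c =
      (j.factorial / (2 * Real.pi * I)) *
        ∮ z in C(c, R), (1 / (z - c) ^ (j + 1)) • f ζ z := by
    intro ζ hζ
    rw [DiffContOnCl.circleIntegral_one_div_sub_center_pow_smul hR j
      ((hf ζ hζ).mono closure_ball_subset_closedBall).diffContOnCl]
    have : (2 * (Real.pi : ℂ) * I) ≠ 0 := by simp [Real.pi_ne_zero]
    have h2 : (j.factorial : ℂ) ≠ 0 := by exact_mod_cast j.factorial_ne_zero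
    rw [smul_eq_mul]
    field_simp
  refine DifferentiableOn.congr ?_ key
  refine DifferentiableOn.const_mul ?_ _
  simp only [circleIntegral]
  simp_rw [intervalIntegral.integral_of_le Real.two_pi_pos.le]
  have hmem : ∀ θ, circleMap c R θ ∈ sphere c R := fun θ => circleMap_mem_sphere c hR.le θ
  refine differentiableOn_integral_of_bound (B := fun _ => R * (1 / R ^ (j + 1)) * B) hW
    (integrable_const _) ?_ ?_ ?_
  · intro ζ hζ
    refine Continuous.aestronglyMeasurable ?_
    simp only [deriv_circleMap]
    have hc : Continuous fun θ => circleMap 0 R θ * I := by fun_prop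
    simp only [smul_eq_mul]
    refine hc.mul (Continuous.mul ?_ ?_)
    · refine continuous_const.div (by fun_prop) fun θ => ?_
      have := circleMap_ne_center (c := c) (θ := θ) hR.ne'
      exact pow_ne_zero _ (sub_ne_zero.2 this)
    · exact (hf ζ hζ).continuousOn.comp_continuous (by fun_prop)
        fun θ => sphere_subset_closedBall (hmem θ)
  · refine Filter.Eventually.of_forall fun θ ζ hζ => ?_
    have h1 : ‖circleMap c R θ - c‖ = R := by
      simpa [dist_eq_norm] using hmem θ
    have h2 : ‖deriv (circleMap c R) θ‖ = R := by
      simp [deriv_circleMap, circleMap, abs_of_pos hR]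
    rw [norm_smul, norm_smul, norm_div, norm_pow, h1, h2, norm_one, mul_assoc]
    have := hb ζ hζ _ (sphere_subset_closedBall (hmem θ))
    gcongr
  · refine Filter.Eventually.of_forall fun θ => ?_
    have := hd _ (sphere_subset_closedBall (hmem θ))
    simp only [smul_eq_mul]
    exact (this.const_mul _).const_mul _

/-- The regularised Mellin transform: for `0 < re z` it equals
`∏_{i ≤ A} (z + i) * ∫ t in 0..1, t ^ (z - 1) * f t`, see `mellinReg_eq`. -/
def mellinReg (A : ℕ) (z : ℂ) (f : ℂ → ℂ) : ℂ :=
  ∑ j ∈ Finset.range (A + 1),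
      (-1) ^ j * (∏ i ∈ Finset.Ico (j + 1) (A + 1), (z + i)) * iteratedDeriv j f 1 +
    (-1) ^ (A + 1) * ∫ t in (0 : ℝ)..1, (t : ℂ) ^ (z + A) * iteratedDeriv (A + 1) f t

/-- A complex neighbourhood of the unit interval of uniform width `ρ`. -/
structure IsUnitNhd (V : Set ℂ) (ρ : ℝ) : Prop where
  isOpen : IsOpen V
  pos : 0 < ρ
  subset : ∀ t ∈ Set.Icc (0 : ℝ) 1, Metric.closedBall (t : ℂ) ρ ⊆ V

theorem IsUnitNhd.mem {V : Set ℂ} {ρ : ℝ} (hV : IsUnitNhd V ρ) {t : ℝ}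
    (ht : t ∈ Set.Icc (0 : ℝ) 1) : (t : ℂ) ∈ V :=
  hV.subset t ht (Metric.mem_closedBall_self hV.pos.le)

theorem IsUnitNhd.zero_mem {V : Set ℂ} {ρ : ℝ} (hV : IsUnitNhd V ρ) : (0 : ℂ) ∈ V := by
  simpa using hV.mem (t := 0) (by simp)

theorem IsUnitNhd.one_mem {V : Set ℂ} {ρ : ℝ} (hV : IsUnitNhd V ρ) : (1 : ℂ) ∈ V := by
  simpa using hV.mem (t := 1) (by simp)

theorem differentiableOn_iteratedDeriv {V : Set ℂ} (hV : IsOpen V) {f : ℂ → ℂ}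
    (hf : DifferentiableOn ℂ f V) (j : ℕ) : DifferentiableOn ℂ (iteratedDeriv j f) V := by
  induction j with
  | zero => simpa using hf
  | succ j ih => rw [iteratedDeriv_succ]; exact ih.deriv hV

theorem norm_iteratedDeriv_le_of_bound {V : Set ℂ} {ρ : ℝ} (hV : IsUnitNhd V ρ) {f : ℂ → ℂ}
    {B : ℝ} (hf : DifferentiableOn ℂ f V) (hB : ∀ t ∈ V, ‖f t‖ ≤ B) (j : ℕ) {t : ℝ}
    (ht : t ∈ Set.Icc (0 : ℝ) 1) :
    ‖iteratedDeriv j f (t : ℂ)‖ ≤ j.factorial * B / ρ ^ j := by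
  refine norm_iteratedDeriv_le_of_forall_mem_sphere_norm_le j hV.pos ?_ ?_
  · exact ((hf.mono (hV.subset t ht)).mono Metric.closure_ball_subset_closedBall).diffContOnCl
  · exact fun z hz => hB z (hV.subset t ht (Metric.sphere_subset_closedBall hz))

theorem continuousOn_comp_ofReal_unit {V : Set ℂ} {ρ : ℝ} (hV : IsUnitNhd V ρ) {g : ℂ → ℂ}
    (hg : DifferentiableOn ℂ g V) :
    ContinuousOn (fun t : ℝ => g t) (Set.Icc 0 1) :=
  hg.continuousOn.comp (by fun_prop) fun _ ht => hV.mem ht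

theorem intervalIntegrable_cpow_mul {V : Set ℂ} {ρ : ℝ} (hV : IsUnitNhd V ρ) {g : ℂ → ℂ}
    (hg : DifferentiableOn ℂ g V) {y : ℂ} (hy : -1 < y.re) :
    IntervalIntegrable (fun t : ℝ => (t : ℂ) ^ y * g t) volume 0 1 := by
  refine (intervalIntegral.intervalIntegrable_cpow' hy).mul_continuousOn ?_
  rw [Set.uIcc_of_le zero_le_one]
  exact continuousOn_comp_ofReal_unit hV hg

theorem mul_integral_cpow_sub_one_mul {V : Set ℂ} {ρ : ℝ} (hV : IsUnitNhd V ρ) {g : ℂ → ℂ}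
    (hg : DifferentiableOn ℂ g V) {y : ℂ} (hy : 0 < y.re) :
    y * ∫ t in (0 : ℝ)..1, (t : ℂ) ^ (y - 1) * g t =
      g 1 - ∫ t in (0 : ℝ)..1, (t : ℂ) ^ y * deriv g t := by
  have hy0 : y ≠ 0 := by rintro rfl; simp at hy
  have key := intervalIntegral.integral_mul_deriv_eq_deriv_mul_of_hasDerivAt
    (a := 0) (b := 1) (u := fun t : ℝ => g t) (u' := fun t : ℝ => deriv g t)
    (v := fun t : ℝ => (t : ℂ) ^ y) (v' := fun t : ℝ => y * (t : ℂ) ^ (y - 1)) ?_ ?_ ?_ ?_ ?_ ?_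
  · simp only [ofReal_one, one_cpow, ofReal_zero, zero_cpow hy0, mul_one, mul_zero,
      sub_zero] at key
    rw [← intervalIntegral.integral_const_mul]
    calc _ = ∫ t in (0 : ℝ)..1, g t * (y * (t : ℂ) ^ (y - 1)) := by
          congr 1; ext t; ring
      _ = _ := key
      _ = _ := by congr 2; ext t; ring
  · rw [Set.uIcc_of_le zero_le_one]; exact continuousOn_comp_ofReal_unit hV hg
  · exact (Complex.continuous_ofReal_cpow_const hy).continuousOn
  · intro t ht
    simp only [min_eq_left (zero_le_one' ℝ), max_eq_right (zero_le_one' ℝ)] at ht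
    have hmem := hV.mem (Set.Ioo_subset_Icc_self ht)
    exact ((hg.differentiableAt (hV.isOpen.mem_nhds hmem)).hasDerivAt).comp_ofReal
  · intro t ht
    simp only [min_eq_left (zero_le_one' ℝ), max_eq_right (zero_le_one' ℝ)] at ht
    exact hasDerivAt_ofReal_cpow_const ht.1.ne' hy0
  · refine ContinuousOn.intervalIntegrable ?_
    rw [Set.uIcc_of_le zero_le_one]
    exact continuousOn_comp_ofReal_unit hV (hg.deriv hV.isOpen)
  · refine (intervalIntegral.intervalIntegrable_cpow' ?_).const_mul y
    simpa using hy

theorem mellinReg_succ {V : Set ℂ} {ρ : ℝ} (hV : IsUnitNhd V ρ) {f : ℂ → ℂ}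
    (hf : DifferentiableOn ℂ f V) (A : ℕ) {z : ℂ} (hz : 0 < (z + A + 1).re) :
    mellinReg (A + 1) z f = (z + A + 1) * mellinReg A z f := by
  have h := mul_integral_cpow_sub_one_mul hV
    (differentiableOn_iteratedDeriv hV.isOpen hf (A + 1)) hz
  rw [← iteratedDeriv_succ] at h
  unfold mellinReg
  rw [Finset.sum_range_succ, mul_add, Finset.mul_sum]
  have e1 : ∀ j ∈ Finset.range (A + 1),
      (-1 : ℂ) ^ j * (∏ i ∈ Finset.Ico (j + 1) (A + 1 + 1), (z + i)) * iteratedDeriv j f 1 =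
      (z + A + 1) * ((-1) ^ j * (∏ i ∈ Finset.Ico (j + 1) (A + 1), (z + i)) *
        iteratedDeriv j f 1) := by
    intro j hj
    rw [Finset.prod_Ico_succ_top (by have := Finset.mem_range.1 hj; lia)]
    push_cast; ring
  rw [Finset.sum_congr rfl e1, add_assoc]
  congr 1
  simp only [add_sub_cancel_right] at h
  simp only [Finset.Ico_self, Finset.prod_empty, mul_one]
  push_cast
  rw [← add_assoc, show (z + A + 1) * ((-1) ^ (A + 1) *
    ∫ t in (0 : ℝ)..1, (t : ℂ) ^ (z + A) * iteratedDeriv (A + 1) f t) = (-1) ^ (A + 1) *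
    ((z + A + 1) * ∫ t in (0 : ℝ)..1, (t : ℂ) ^ (z + A) * iteratedDeriv (A + 1) f t) by ring, h]
  ring

theorem mellinReg_eq {V : Set ℂ} {ρ : ℝ} (hV : IsUnitNhd V ρ) {f : ℂ → ℂ}
    (hf : DifferentiableOn ℂ f V) (A : ℕ) {z : ℂ} (hz : 0 < z.re) :
    mellinReg A z f = (∏ i ∈ Finset.range (A + 1), (z + i)) *
      ∫ t in (0 : ℝ)..1, (t : ℂ) ^ (z - 1) * f t := by
  induction A with
  | zero =>
    simp only [mellinReg, zero_add, Finset.range_one, Finset.sum_singleton, pow_zero,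
      Finset.Ico_self, Finset.prod_empty, mul_one, iteratedDeriv_zero, one_mul, pow_one,
      CharP.cast_eq_zero, add_zero, iteratedDeriv_one, Finset.prod_singleton,
      mul_integral_cpow_sub_one_mul hV hf hz]
    ring
  | succ A ih =>
    rw [mellinReg_succ hV hf A (by simp; positivity), ih, Finset.prod_range_succ _ (A + 1)]
    push_cast; ring

theorem mellinReg_neg {V : Set ℂ} {ρ : ℝ} (hV : IsUnitNhd V ρ) {f : ℂ → ℂ}
    (hf : DifferentiableOn ℂ f V) (A : ℕ) :
    mellinReg A (-A) f = (-1) ^ A * iteratedDeriv A f 0 := by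
  have hd := differentiableOn_iteratedDeriv hV.isOpen hf A
  have ftc : ∫ t in (0 : ℝ)..1, iteratedDeriv (A + 1) f t =
      iteratedDeriv A f 1 - iteratedDeriv A f 0 := by
    have := intervalIntegral.integral_eq_sub_of_hasDerivAt (a := 0) (b := 1)
      (f := fun t : ℝ => iteratedDeriv A f t) (f' := fun t : ℝ => iteratedDeriv (A + 1) f t) ?_ ?_
    · simpa using this
    · intro t ht
      rw [Set.uIcc_of_le zero_le_one] at ht
      rw [iteratedDeriv_succ]
      exact ((hd.differentiableAt (hV.isOpen.mem_nhds (hV.mem ht))).hasDerivAt).comp_ofReal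
    · refine ContinuousOn.intervalIntegrable ?_
      rw [Set.uIcc_of_le zero_le_one]
      exact continuousOn_comp_ofReal_unit hV (differentiableOn_iteratedDeriv hV.isOpen hf (A + 1))
  unfold mellinReg
  simp only [neg_add_cancel, cpow_zero, one_mul]
  rw [ftc, Finset.sum_range_succ, Finset.sum_eq_zero]
  · simp; ring
  · intro j hj
    rw [Finset.prod_eq_zero (i := A)]
    · simp
    · simp at hj ⊢; lia
    · simp

theorem norm_mellinReg_kernel_le {V : Set ℂ} {ρ : ℝ} (hV : IsUnitNhd V ρ) {f : ℂ → ℂ} {B : ℝ}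
    (hf : DifferentiableOn ℂ f V) (hB : ∀ t ∈ V, ‖f t‖ ≤ B) (A : ℕ) {z : ℂ}
    (hz : -(1 / 2) ≤ z.re + A) {t : ℝ} (ht : t ∈ Set.Ioc (0 : ℝ) 1) :
    ‖(t : ℂ) ^ (z + A) * iteratedDeriv (A + 1) f t‖ ≤
      t ^ (-(1 / 2) : ℝ) * ((A + 1).factorial * B / ρ ^ (A + 1)) := by
  rw [norm_mul, norm_cpow_eq_rpow_re_of_pos ht.1]
  have h1 := norm_iteratedDeriv_le_of_bound hV hf hB (A + 1) (Set.Ioc_subset_Icc_self ht)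
  have h2 : t ^ (z + A).re ≤ t ^ (-(1 / 2) : ℝ) := by
    refine Real.rpow_le_rpow_of_exponent_ge ht.1 ht.2 ?_
    simpa using hz
  have := ht.1
  gcongr

theorem integrable_rpow_neg_half :
    Integrable (fun t : ℝ => t ^ (-(1 / 2) : ℝ)) (volume.restrict (Set.Ioc 0 1)) := by
  have := intervalIntegral.intervalIntegrable_rpow' (a := 0) (b := 1) (r := -(1 / 2)) (by norm_num)
  rwa [intervalIntegrable_iff_integrableOn_Ioc_of_le zero_le_one] at this

theorem exists_bound_mellinReg {V : Set ℂ} {ρ : ℝ} (hV : IsUnitNhd V ρ) (A : ℕ) (R : ℝ) :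
    ∃ C : ℝ, 0 ≤ C ∧ ∀ (f : ℂ → ℂ) (B : ℝ) (z : ℂ), DifferentiableOn ℂ f V → (∀ t ∈ V, ‖f t‖ ≤ B) →
      ‖z‖ ≤ R → -(1 / 2) ≤ z.re + A → ‖mellinReg A z f‖ ≤ C * B := by
  refine ⟨∑ j ∈ Finset.range (A + 1),
      (∏ i ∈ Finset.Ico (j + 1) (A + 1), (|R| + i)) * (j.factorial / ρ ^ j) +
      (∫ t in Set.Ioc (0 : ℝ) 1, t ^ (-(1 / 2) : ℝ)) * ((A + 1).factorial / ρ ^ (A + 1)),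
      ?_, ?_⟩
  · have := hV.pos
    have : 0 ≤ ∫ t in Set.Ioc (0 : ℝ) 1, t ^ (-(1 / 2) : ℝ) :=
      setIntegral_nonneg measurableSet_Ioc fun t ht => Real.rpow_nonneg ht.1.le _
    positivity
  · intro f B z hf hB hz hz2
    have hR : ‖z‖ ≤ |R| := hz.trans (le_abs_self R)
    unfold mellinReg
    refine (norm_add_le _ _).trans ?_
    rw [add_mul]
    refine add_le_add ?_ ?_
    · rw [Finset.sum_mul]
      refine (norm_sum_le _ _).trans (Finset.sum_le_sum fun j _ => ?_)
      rw [norm_mul, norm_mul, norm_pow, norm_neg, norm_one, one_pow, one_mul, mul_assoc,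
        Finset.prod_congr rfl fun i _ => rfl, norm_prod]
      have h1 := norm_iteratedDeriv_le_of_bound hV hf hB j (t := 1) (by simp)
      rw [ofReal_one, mul_div_right_comm] at h1
      gcongr with i hi
      refine (norm_add_le _ _).trans ?_
      simpa using hR
    · rw [norm_mul, norm_pow, norm_neg, norm_one, one_pow, one_mul,
        intervalIntegral.integral_of_le zero_le_one]
      refine (norm_integral_le_of_norm_le
        (integrable_rpow_neg_half.mul_const ((A + 1).factorial * B / ρ ^ (A + 1))) ?_).trans ?_
      · filter_upwards [ae_restrict_mem measurableSet_Ioc] with t ht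
        exact norm_mellinReg_kernel_le hV hf hB A hz2 ht
      · rw [integral_mul_const]
        apply le_of_eq; ring

theorem differentiableOn_mellinReg {V : Set ℂ} {ρ : ℝ} (hV : IsUnitNhd V ρ) (A : ℕ) {W : Set ℂ}
    (hW : IsOpen W) {f : ℂ → ℂ → ℂ} {z : ℂ → ℂ} {B : ℝ} (hz : DifferentiableOn ℂ z W)
    (hz2 : ∀ ζ ∈ W, -(1 / 2) ≤ (z ζ).re + A) (hf : ∀ ζ ∈ W, DifferentiableOn ℂ (f ζ) V)
    (hB : ∀ ζ ∈ W, ∀ t ∈ V, ‖f ζ t‖ ≤ B) (hd : ∀ t ∈ V, DifferentiableOn ℂ (fun ζ => f ζ t) W) :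
    DifferentiableOn ℂ (fun ζ => mellinReg A (z ζ) (f ζ)) W := by
  have hder : ∀ (j : ℕ) (t : ℝ), t ∈ Set.Icc (0 : ℝ) 1 →
      DifferentiableOn ℂ (fun ζ => iteratedDeriv j (f ζ) t) W := fun j t ht =>
    differentiableOn_iteratedDeriv_param hW hV.pos j
      (fun ζ hζ => (hf ζ hζ).mono (hV.subset t ht))
      (fun ζ hζ u hu => hB ζ hζ u (hV.subset t ht hu)) fun u hu => hd u (hV.subset t ht hu)
  unfold mellinReg
  refine DifferentiableOn.add ?_ (DifferentiableOn.const_mul ?_ _)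
  · refine DifferentiableOn.fun_sum fun j _ => ?_
    refine DifferentiableOn.mul ?_ (by simpa using hder j 1 (by simp))
    refine DifferentiableOn.const_mul ?_ _
    refine DifferentiableOn.fun_finsetProd fun i _ => ?_
    exact hz.add_const _
  · simp_rw [intervalIntegral.integral_of_le zero_le_one]
    refine differentiableOn_integral_of_bound hW
      (integrable_rpow_neg_half.mul_const ((A + 1).factorial * B / ρ ^ (A + 1))) ?_ ?_ ?_
    · intro ζ hζ
      have := intervalIntegrable_cpow_mul hV (differentiableOn_iteratedDeriv hV.isOpen
        (hf ζ hζ) (A + 1)) (y := z ζ + A) (by have := hz2 ζ hζ; simp; linarith)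
      rw [intervalIntegrable_iff_integrableOn_Ioc_of_le zero_le_one] at this
      exact this.aestronglyMeasurable
    · filter_upwards [ae_restrict_mem measurableSet_Ioc] with t ht ζ hζ
      exact norm_mellinReg_kernel_le hV (hf ζ hζ) (hB ζ hζ) A (hz2 ζ hζ) ht
    · filter_upwards [ae_restrict_mem measurableSet_Ioc] with t ht
      refine DifferentiableOn.mul ?_ (hder (A + 1) t (Set.Ioc_subset_Icc_self ht))
      have h0 : (t : ℂ) ≠ 0 := by exact_mod_cast ht.1.ne'
      exact (hz.add_const _).const_cpow (Or.inl h0)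

/-- Iterated regularised Mellin transform in the variables `u 0, …, u (r - 1)`. -/
def mellinFold : (r : ℕ) → (Fin r → ℕ) → (Fin r → ℂ) → ((Fin r → ℂ) → ℂ) → ℂ
  | 0, _, _, f => f Fin.elim0
  | r + 1, A, z, f => mellinFold r (Fin.tail A) (Fin.tail z) fun v =>
      mellinReg (A 0) (z 0) fun t => f (Fin.cons t v)

/-- Functions on `V ^ r` bounded by `B` and holomorphic in each variable. -/
structure SepHol {r : ℕ} (V : Set ℂ) (B : ℝ) (f : (Fin r → ℂ) → ℂ) : Prop where
  bound : ∀ u, (∀ k, u k ∈ V) → ‖f u‖ ≤ B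
  hol : ∀ u, (∀ k, u k ∈ V) → ∀ k, DifferentiableOn ℂ (fun t => f (Function.update u k t)) V

/-- Families `f s u`, holomorphic in `s ∈ W` and in each `u k ∈ V`, and uniformly bounded. -/
structure HolB {r : ℕ} (W V : Set ℂ) (B : ℝ) (f : ℂ → (Fin r → ℂ) → ℂ) : Prop where
  sep : ∀ s ∈ W, SepHol V B (f s)
  hol : ∀ u, (∀ k, u k ∈ V) → DifferentiableOn ℂ (fun s => f s u) W

theorem forall_cons_mem {r : ℕ} {V : Set ℂ} {v : Fin r → ℂ} (hv : ∀ k, v k ∈ V) {t : ℂ}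
    (ht : t ∈ V) : ∀ k, (Fin.cons t v : Fin (r + 1) → ℂ) k ∈ V := by
  intro k
  refine Fin.cases ?_ (fun i => ?_) k
  · simpa using ht
  · simpa using hv i

theorem SepHol.cons_hol {r : ℕ} {V : Set ℂ} {B : ℝ} {f : (Fin (r + 1) → ℂ) → ℂ}
    (hf : SepHol V B f) (hV : (0 : ℂ) ∈ V) {v : Fin r → ℂ} (hv : ∀ k, v k ∈ V) :
    DifferentiableOn ℂ (fun t => f (Fin.cons t v)) V := by
  have := hf.hol (Fin.cons 0 v) (forall_cons_mem hv hV) 0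
  simpa only [Fin.update_cons_zero] using this

theorem SepHol.mellinReg {r : ℕ} {V : Set ℂ} {ρ B C : ℝ} (hV : IsUnitNhd V ρ) {A : ℕ} {z : ℂ}
    (hz : -(1 / 2) ≤ z.re + A) {f : (Fin (r + 1) → ℂ) → ℂ} (hf : SepHol V B f)
    (hC : ∀ f : ℂ → ℂ, DifferentiableOn ℂ f V → (∀ t ∈ V, ‖f t‖ ≤ B) → ‖mellinReg A z f‖ ≤ C * B) :
    SepHol V (C * B) fun v => mellinReg A z fun t => f (Fin.cons t v) where
  bound v hv := hC _ (hf.cons_hol hV.zero_mem hv) fun t ht => hf.bound _ (forall_cons_mem hv ht)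
  hol v hv k := by
    have hupd : ∀ x ∈ V, ∀ i, Function.update v k x i ∈ V := by
      intro x hx i
      by_cases h : i = k
      · subst h; simpa using hx
      · simpa [h] using hv i
    refine differentiableOn_mellinReg hV A hV.isOpen (B := B)
      (differentiableOn_const z) (fun _ _ => hz) ?_ ?_ ?_
    · exact fun x hx => hf.cons_hol hV.zero_mem (hupd x hx)
    · exact fun x hx t ht => hf.bound _ (forall_cons_mem (hupd x hx) ht)
    · intro t ht
      have := hf.hol (Fin.cons t v) (forall_cons_mem hv ht) k.succ
      simpa only [Fin.cons_update] using this

theorem HolB.differentiableOn_mellinFold {W V : Set ℂ} {ρ : ℝ} (hV : IsUnitNhd V ρ)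
    (hW : IsOpen W) {r : ℕ} (A : Fin r → ℕ) (z : ℂ → Fin r → ℂ) (R : ℝ)
    (hz : ∀ k, DifferentiableOn ℂ (fun s => z s k) W) (hzR : ∀ k, ∀ s ∈ W, ‖z s k‖ ≤ R)
    (hzA : ∀ k, ∀ s ∈ W, -(1 / 2) ≤ (z s k).re + A k) {B : ℝ} {f : ℂ → (Fin r → ℂ) → ℂ}
    (hf : HolB W V B f) : DifferentiableOn ℂ (fun s => mellinFold r A (z s) (f s)) W := by
  induction r generalizing B with
  | zero => exact hf.hol _ fun k => k.elim0
  | succ r ih =>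
    obtain ⟨C, -, hC⟩ := exists_bound_mellinReg hV (A 0) R
    refine ih (Fin.tail A) (fun s => Fin.tail (z s)) (fun k => hz k.succ) (fun k => hzR k.succ)
      (fun k => hzA k.succ) (B := C * B)
      (f := fun s v => mellinReg (A 0) (z s 0) fun t => f s (Fin.cons t v)) ⟨?_, ?_⟩
    · exact fun s hs => (hf.sep s hs).mellinReg hV (hzA 0 s hs)
        fun g hg hgB => hC g B _ hg hgB (hzR 0 s hs) (hzA 0 s hs)
    · intro v hv
      refine differentiableOn_mellinReg hV (A 0) hW (hz 0) (hzA 0) (B := B) ?_ ?_ ?_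
      · exact fun s hs => (hf.sep s hs).cons_hol hV.zero_mem hv
      · exact fun s hs t ht => (hf.sep s hs).bound _ (forall_cons_mem hv ht)
      · exact fun t ht => hf.hol _ (forall_cons_mem hv ht)

theorem iteratedDeriv_congr_of_isOpen {V : Set ℂ} (hV : IsOpen V) {f g : ℂ → ℂ}
    (h : Set.EqOn f g V) (j : ℕ) {t : ℂ} (ht : t ∈ V) : iteratedDeriv j f t = iteratedDeriv j g t :=
  Filter.EventuallyEq.iteratedDeriv_eq j (Filter.eventuallyEq_of_mem (hV.mem_nhds ht) h)

theorem mellinReg_congr {V : Set ℂ} {ρ : ℝ} (hV : IsUnitNhd V ρ) (A : ℕ) (z : ℂ) {f g : ℂ → ℂ}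
    (h : Set.EqOn f g V) : mellinReg A z f = mellinReg A z g := by
  unfold mellinReg
  congr 1
  · refine Finset.sum_congr rfl fun j _ => ?_
    rw [iteratedDeriv_congr_of_isOpen hV.isOpen h j hV.one_mem]
  · congr 1
    refine intervalIntegral.integral_congr fun t ht => ?_
    rw [Set.uIcc_of_le zero_le_one] at ht
    simp only [iteratedDeriv_congr_of_isOpen hV.isOpen h (A + 1) (hV.mem ht)]

theorem mellinFold_congr {V : Set ℂ} {ρ : ℝ} (hV : IsUnitNhd V ρ) {r : ℕ} (A : Fin r → ℕ)
    (z : Fin r → ℂ) {f g : (Fin r → ℂ) → ℂ} (h : ∀ u, (∀ k, u k ∈ V) → f u = g u) :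
    mellinFold r A z f = mellinFold r A z g := by
  induction r with
  | zero => exact h _ fun k => k.elim0
  | succ r ih =>
    exact ih _ _ fun v hv => mellinReg_congr hV _ _ fun t ht => h _ (forall_cons_mem hv ht)

/-- Lebesgue measure on the unit interval. -/
abbrev unitMeasure : Measure ℝ := volume.restrict (Set.Ioc 0 1)

theorem ae_pi_unitMeasure_mem (r : ℕ) :
    ∀ᵐ u ∂(Measure.pi fun _ : Fin r => unitMeasure), ∀ k, u k ∈ Set.Ioc (0 : ℝ) 1 := by
  refine ae_all_iff.2 fun k => ?_
  exact (Measure.tendsto_eval_ae_ae (μ := fun _ : Fin r => unitMeasure)).eventually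
    (ae_restrict_mem measurableSet_Ioc)

theorem integrable_prod_cpow {r : ℕ} {z : Fin r → ℂ} (hz : ∀ k, 0 < (z k).re) :
    Integrable (fun u : Fin r → ℝ => ∏ k, (u k : ℂ) ^ (z k - 1))
      (Measure.pi fun _ => unitMeasure) := by
  refine Integrable.fintype_prod (f := fun k (t : ℝ) => (t : ℂ) ^ (z k - 1)) fun k => ?_
  have := intervalIntegral.intervalIntegrable_cpow' (a := 0) (b := 1) (r := z k - 1)
    (by simpa using hz k)
  rwa [intervalIntegrable_iff_integrableOn_Ioc_of_le zero_le_one] at this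

theorem integrable_prod_cpow_mul {r : ℕ} {z : Fin r → ℂ} (hz : ∀ k, 0 < (z k).re) {V : Set ℂ}
    {ρ B : ℝ} (hV : IsUnitNhd V ρ) {f : (Fin r → ℂ) → ℂ}
    (hf : ∀ u, (∀ k, u k ∈ V) → ‖f u‖ ≤ B)
    (hm : AEStronglyMeasurable (fun u : Fin r → ℝ => f fun k => (u k : ℂ))
      (Measure.pi fun _ => unitMeasure)) :
    Integrable (fun u : Fin r → ℝ => (∏ k, (u k : ℂ) ^ (z k - 1)) * f fun k => (u k : ℂ))
      (Measure.pi fun _ => unitMeasure) := by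
  refine (integrable_prod_cpow hz).mul_bdd (c := B) hm ?_
  filter_upwards [ae_pi_unitMeasure_mem r] with u hu
  exact hf _ fun k => hV.mem (Set.Ioc_subset_Icc_self (hu k))

theorem measurePreserving_cons_unit (r : ℕ) :
    MeasurePreserving (MeasurableEquiv.piFinSuccAbove (fun _ : Fin (r + 1) => ℝ) 0).symm
      (unitMeasure.prod (Measure.pi fun _ : Fin r => unitMeasure))
      (Measure.pi fun _ : Fin (r + 1) => unitMeasure) :=
  (measurePreserving_piFinSuccAbove (fun _ : Fin (r + 1) => unitMeasure) 0).symm _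

theorem piFinSuccAbove_symm_ofReal {r : ℕ} (p : ℝ × (Fin r → ℝ)) :
    (fun k => (((MeasurableEquiv.piFinSuccAbove (fun _ : Fin (r + 1) => ℝ) 0).symm p k : ℝ) : ℂ)) =
      Fin.cons (p.1 : ℂ) fun k => (p.2 k : ℂ) := by
  funext k
  refine Fin.cases ?_ (fun i => ?_) k <;> simp [MeasurableEquiv.piFinSuccAbove]

theorem mellinFold_eq_integral {V : Set ℂ} {ρ B : ℝ} (hV : IsUnitNhd V ρ) {r : ℕ} (A : Fin r → ℕ)
    {z : Fin r → ℂ} (hz : ∀ k, 0 < (z k).re) {f : (Fin r → ℂ) → ℂ} (hf : SepHol V B f)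
    (hm : AEStronglyMeasurable (fun u : Fin r → ℝ => f fun k => (u k : ℂ))
      (Measure.pi fun _ => unitMeasure)) :
    mellinFold r A z f = (∏ k, ∏ i ∈ Finset.range (A k + 1), (z k + i)) *
      ∫ u : Fin r → ℝ, (∏ k, (u k : ℂ) ^ (z k - 1)) * f (fun k => (u k : ℂ))
        ∂(Measure.pi fun _ => unitMeasure) := by
  induction r generalizing B with
  | zero =>
    rw [Measure.pi_of_empty (fun _ : Fin 0 => unitMeasure) Fin.elim0, integral_dirac]
    simp only [mellinFold, Finset.univ_eq_empty, Finset.prod_empty, one_mul]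
    congr 1
    exact Subsingleton.elim _ _
  | succ r ih =>
    have hzA : -(1 / 2) ≤ (z 0).re + A 0 := by
      have := hz 0
      have : (0 : ℝ) ≤ A 0 := Nat.cast_nonneg _
      linarith
    obtain ⟨C, -, hC⟩ := exists_bound_mellinReg hV (A 0) ‖z 0‖
    have hG := hf.mellinReg hV hzA fun g hg hgB => hC g B _ hg hgB le_rfl hzA
    set G : (Fin r → ℂ) → ℂ := fun v => mellinReg (A 0) (z 0) fun t => f (Fin.cons t v) with hGdef
    have hGe : ∀ v : Fin r → ℝ, (∀ k, v k ∈ Set.Ioc (0 : ℝ) 1) →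
        G (fun k => (v k : ℂ)) = (∏ i ∈ Finset.range (A 0 + 1), (z 0 + i)) *
          ∫ t, (t : ℂ) ^ (z 0 - 1) * f (Fin.cons (t : ℂ) fun k => (v k : ℂ)) ∂unitMeasure := by
      intro v hv
      have := hf.cons_hol hV.zero_mem fun k => hV.mem (Set.Ioc_subset_Icc_self (hv k))
      rw [← intervalIntegral.integral_of_le zero_le_one]
      exact mellinReg_eq hV this (A 0) (hz 0)
    have hmc := hm.comp_measurePreserving (measurePreserving_cons_unit r)
    simp only [Function.comp_def, piFinSuccAbove_symm_ofReal] at hmc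
    have hGm : AEStronglyMeasurable (fun u : Fin r → ℝ => G fun k => (u k : ℂ))
        (Measure.pi fun _ => unitMeasure) := by
      have h1 : AEStronglyMeasurable (fun p : ℝ × (Fin r → ℝ) =>
          (p.1 : ℂ) ^ (z 0 - 1) * f (Fin.cons (p.1 : ℂ) fun k => (p.2 k : ℂ)))
          (unitMeasure.prod (Measure.pi fun _ : Fin r => unitMeasure)) := by
        refine AEStronglyMeasurable.mul ?_ hmc
        have : Measurable fun p : ℝ × (Fin r → ℝ) => (p.1 : ℂ) ^ (z 0 - 1) := by fun_prop
        exact this.aestronglyMeasurable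
      have h2 := (h1.prod_swap.integral_prod_right').const_mul
        (∏ i ∈ Finset.range (A 0 + 1), (z 0 + i))
      refine h2.congr ?_
      filter_upwards [ae_pi_unitMeasure_mem r] with v hv
      exact (hGe v hv).symm
    have hint := integrable_prod_cpow_mul hz hV hf.bound hm
    have hint' := (measurePreserving_cons_unit r).integrable_comp_of_integrable hint
    simp only [Function.comp_def] at hint'
    have step := ih (Fin.tail A) (z := Fin.tail z) (fun k => hz k.succ) hG hGm
    change mellinFold r (Fin.tail A) (Fin.tail z) G = _
    rw [step, ← (measurePreserving_cons_unit r).integral_comp'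
      (g := fun u : Fin (r + 1) → ℝ => (∏ k, (u k : ℂ) ^ (z k - 1)) * f fun k => (u k : ℂ)),
      integral_prod_symm _ hint', Fin.prod_univ_succ (n := r),
      mul_comm (∏ i ∈ Finset.range (A 0 + 1), (z 0 + i)),
      mul_assoc]
    simp only [Fin.tail]
    congr 1
    rw [← integral_const_mul]
    refine integral_congr_ae ?_
    filter_upwards [ae_pi_unitMeasure_mem r] with v hv
    rw [hGe v hv, mul_left_comm, ← integral_const_mul]
    congr 1
    refine integral_congr_ae (Filter.Eventually.of_forall fun t => ?_)
    have := piFinSuccAbove_symm_ofReal (t, v)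
    simp only [this]
    have h0 := congrFun this 0
    have hs := fun k : Fin r => congrFun this k.succ
    simp only [Fin.cons_zero, Fin.cons_succ] at h0 hs
    rw [Fin.prod_univ_succ]
    simp only [h0, hs]
    ring

/-- Functions of `w` given by a polynomial with coefficients in `K`. -/
def PolyFun {σ : Type*} (K : Subfield ℂ) (F : (σ → ℂ) → ℂ) : Prop :=
  ∃ p : MvPolynomial σ K, ∀ w, F w = MvPolynomial.aeval w p

namespace PolyFun

variable {σ : Type*} {K : Subfield ℂ} {F G : (σ → ℂ) → ℂ}

theorem const {c : ℂ} (hc : c ∈ K) : PolyFun K (fun _ : σ → ℂ => c) :=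
  ⟨MvPolynomial.C ⟨c, hc⟩, fun w => by simp; rfl⟩

theorem var (j : σ) : PolyFun K (fun w : σ → ℂ => w j) :=
  ⟨MvPolynomial.X j, fun w => by simp⟩

theorem add (hF : PolyFun K F) (hG : PolyFun K G) : PolyFun K fun w => F w + G w := by
  obtain ⟨p, hp⟩ := hF
  obtain ⟨q, hq⟩ := hG
  exact ⟨p + q, fun w => by simp [hp, hq]⟩

theorem mul (hF : PolyFun K F) (hG : PolyFun K G) : PolyFun K fun w => F w * G w := by
  obtain ⟨p, hp⟩ := hF
  obtain ⟨q, hq⟩ := hG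
  exact ⟨p * q, fun w => by simp [hp, hq]⟩

theorem sum {ι : Type*} (s : Finset ι) {F : ι → (σ → ℂ) → ℂ} (h : ∀ i ∈ s, PolyFun K (F i)) :
    PolyFun K fun w => ∑ i ∈ s, F i w := by
  induction s using Finset.induction_on with
  | empty => simpa using const K.zero_mem
  | insert i s hi ih =>
    simp only [Finset.sum_insert hi]
    exact (h i (by simp)).add (ih fun j hj => h j (by simp [hj]))

theorem exists_complex (hF : PolyFun K F) : ∃ p : MvPolynomial σ ℂ,
    (∀ d, p.coeff d ∈ K) ∧ ∀ w, F w = MvPolynomial.eval w p := by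
  obtain ⟨p, hp⟩ := hF
  refine ⟨p.map K.subtype, fun d => ?_, fun w => ?_⟩
  · rw [MvPolynomial.coeff_map]; exact (p.coeff d).2
  · rw [hp, MvPolynomial.eval_map]; rfl

theorem smul_comp {c : ℂ} (hc : c ∈ K) (hF : PolyFun K F) :
    PolyFun K fun w => F fun j => c * w j := by
  obtain ⟨p, hp⟩ := hF
  refine ⟨p.bind₁ fun j => MvPolynomial.C ⟨c, hc⟩ * MvPolynomial.X j, fun w => ?_⟩
  beta_reduce
  rw [hp, MvPolynomial.aeval_bind₁]
  congr 2
  ext j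
  simp only [map_mul, MvPolynomial.aeval_C, MvPolynomial.aeval_X]
  rfl

end PolyFun

/-- Functions of `u ∈ V ^ r` built from the coordinates and from polynomial functions of a
parameter `w` by ring operations and composition with holomorphic functions having all
derivatives in `K` at the value for `u = 0`. -/
inductive Nice {σ : Type*} (K : Subfield ℂ) (V : Set ℂ) (r : ℕ) :
    ((σ → ℂ) → (Fin r → ℂ) → ℂ) → Prop
  | param {F : (σ → ℂ) → ℂ} : PolyFun K F → Nice K V r fun w _ => F w
  | var (k : Fin r) : Nice K V r fun _ u => u k
  | add {f g} : Nice K V r f → Nice K V r g → Nice K V r fun w u => f w u + g w u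
  | mul {f g} : Nice K V r f → Nice K V r g → Nice K V r fun w u => f w u * g w u
  | comp {f} {φ : ℂ → ℂ} {W : Set ℂ} {c : ℂ} : IsOpen W → DifferentiableOn ℂ φ W → c ∈ W →
      (∀ j, iteratedDeriv j φ c ∈ K) → Nice K V r f →
      (∀ w u, (∀ k, u k ∈ V) → f w u ∈ W) → (∀ w, f w 0 = c) → Nice K V r fun w u => φ (f w u)

namespace Nice

variable {σ : Type*} {K : Subfield ℂ} {V : Set ℂ} {r : ℕ} {f : (σ → ℂ) → (Fin r → ℂ) → ℂ}

theorem const {c : ℂ} (hc : c ∈ K) : Nice K V r fun (_ : σ → ℂ) _ => c := param (.const hc)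

theorem sum {ι : Type*} (s : Finset ι) {f : ι → (σ → ℂ) → (Fin r → ℂ) → ℂ}
    (h : ∀ i ∈ s, Nice K V r (f i)) : Nice K V r fun w u => ∑ i ∈ s, f i w u := by
  induction s using Finset.induction_on with
  | empty => simpa using const K.zero_mem
  | insert i s hi ih =>
    simp only [Finset.sum_insert hi]
    exact (h i (by simp)).add (ih fun j hj => h j (by simp [hj]))

theorem prod {ι : Type*} (s : Finset ι) {f : ι → (σ → ℂ) → (Fin r → ℂ) → ℂ}
    (h : ∀ i ∈ s, Nice K V r (f i)) : Nice K V r fun w u => ∏ i ∈ s, f i w u := by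
  induction s using Finset.induction_on with
  | empty => simpa using const K.one_mem
  | insert i s hi ih =>
    simp only [Finset.prod_insert hi]
    exact (h i (by simp)).mul (ih fun j hj => h j (by simp [hj]))

theorem polyFun_zero (hf : Nice K V r f) : PolyFun K fun w => f w 0 := by
  induction hf with
  | param h => exact h
  | var k => exact .const K.zero_mem
  | add _ _ hf hg => exact hf.add hg
  | mul _ _ hf hg => exact hf.mul hg
  | comp _ _ _ hK _ _ h0 _ => simpa only [h0] using PolyFun.const (by simpa using hK 0)

theorem cons_zero (hV : (0 : ℂ) ∈ V) {f : (σ → ℂ) → (Fin (r + 1) → ℂ) → ℂ}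
    (hf : Nice K V (r + 1) f) : Nice K V r fun w v => f w (Fin.cons 0 v) := by
  induction hf with
  | param h => exact .param h
  | var k =>
    refine Fin.cases ?_ (fun i => ?_) k
    · simpa using const K.zero_mem
    · simpa using .var i
  | add _ _ hf hg => exact hf.add hg
  | mul _ _ hf hg => exact hf.mul hg
  | comp hW hφ hc hK _ hmem h0 hf =>
    refine .comp hW hφ hc hK hf (fun w u hu => hmem _ _ (forall_cons_mem hu hV)) fun w => ?_
    rw [← h0 w]
    congr 1
    funext k
    refine Fin.cases ?_ (fun i => ?_) k <;> simp

theorem exists_hasDerivAt (hf : Nice K V r f) (k : Fin r) : ∃ g : (σ → ℂ) → (Fin r → ℂ) → ℂ,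
    Nice K V r g ∧ ∀ w u, (∀ k, u k ∈ V) →
      HasDerivAt (fun t => f w (Function.update u k t)) (g w u) (u k) := by
  induction hf with
  | param h => exact ⟨_, const K.zero_mem, fun w u _ => hasDerivAt_const _ _⟩
  | var i =>
    by_cases h : i = k
    · subst h
      exact ⟨_, const K.one_mem, fun w u _ => by simpa using hasDerivAt_id' _⟩
    · exact ⟨_, const K.zero_mem, fun w u _ => by simpa [h] using hasDerivAt_const _ _⟩
  | add _ _ hf hg =>
    obtain ⟨f', hf', hfd⟩ := hf
    obtain ⟨g', hg', hgd⟩ := hg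
    exact ⟨_, hf'.add hg', fun w u hu => (hfd w u hu).add (hgd w u hu)⟩
  | mul hfn hgn hf hg =>
    obtain ⟨f', hf', hfd⟩ := hf
    obtain ⟨g', hg', hgd⟩ := hg
    refine ⟨_, (hf'.mul hgn).add (hfn.mul hg'), fun w u hu => ?_⟩
    simpa using (hfd w u hu).fun_mul (hgd w u hu)
  | @comp f φ W c hW hφ hc hK hfn hmem h0 hf =>
    obtain ⟨f', hf', hfd⟩ := hf
    have hd : Nice K V r fun w u => deriv φ (f w u) :=
      .comp hW (hφ.deriv hW) hc (fun j => by rw [← iteratedDeriv_succ']; exact hK _) hfn hmem h0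
    refine ⟨_, hd.mul hf', fun w u hu => ?_⟩
    have h1 := (hφ.differentiableAt (hW.mem_nhds (hmem w u hu))).hasDerivAt
    exact HasDerivAt.comp_of_eq (h₂ := φ) (u k) h1 (hfd w u hu) (by simp)

theorem differentiableOn (hf : Nice K V r f) (w : σ → ℂ) {u : Fin r → ℂ} (hu : ∀ k, u k ∈ V)
    (k : Fin r) : DifferentiableOn ℂ (fun t => f w (Function.update u k t)) V := by
  obtain ⟨g, -, hg⟩ := hf.exists_hasDerivAt k
  intro t ht
  have := hg w (Function.update u k t) fun i => by
    by_cases h : i = k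
    · subst h; simpa using ht
    · simpa [h] using hu i
  simp only [Function.update_idem, Function.update_self] at this
  exact this.differentiableAt.differentiableWithinAt

theorem exists_iteratedDeriv (hV : IsOpen V) (hf : Nice K V r f) (k : Fin r) (A : ℕ) :
    ∃ g : (σ → ℂ) → (Fin r → ℂ) → ℂ, Nice K V r g ∧ ∀ w u, (∀ k, u k ∈ V) →
      iteratedDeriv A (fun t => f w (Function.update u k t)) (u k) = g w u := by
  induction A with
  | zero => exact ⟨f, hf, fun w u _ => by simp⟩
  | succ A ih =>
    obtain ⟨g, hg, hgd⟩ := ih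
    obtain ⟨g', hg', hgd'⟩ := hg.exists_hasDerivAt k
    refine ⟨g', hg', fun w u hu => ?_⟩
    rw [iteratedDeriv_succ, ← (hgd' w u hu).deriv]
    refine Filter.EventuallyEq.deriv_eq ?_
    filter_upwards [hV.mem_nhds (hu k)] with t ht
    have := hgd w (Function.update u k t) fun i => by
      by_cases h : i = k
      · subst h; simpa using ht
      · simpa [h] using hu i
    simpa only [Function.update_idem, Function.update_self] using this

theorem polyFun_mellinFold {ρ : ℝ} (hV : IsUnitNhd V ρ) (hf : Nice K V r f) (A : Fin r → ℕ) :
    PolyFun K fun w => mellinFold r A (fun k => -(A k : ℂ)) (f w) := by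
  induction r with
  | zero =>
    have := hf.polyFun_zero
    simpa only [mellinFold, Subsingleton.elim (0 : Fin 0 → ℂ) Fin.elim0] using this
  | succ r ih =>
    obtain ⟨g, hg, hgd⟩ := hf.exists_iteratedDeriv hV.isOpen 0 (A 0)
    have hG : Nice K V r fun w v => (-1 : ℂ) ^ A 0 * g w (Fin.cons 0 v) :=
      (const (K.pow_mem (K.neg_mem K.one_mem) _)).mul (hg.cons_zero hV.zero_mem)
    have := ih hG (Fin.tail A)
    convert this using 2 with w
    rw [mellinFold]
    refine mellinFold_congr hV _ _ fun v hv => ?_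
    have h0 := forall_cons_mem hv hV.zero_mem
    rw [← hgd w _ h0, mellinReg_neg hV]
    · simp only [Fin.update_cons_zero, Fin.cons_zero]
    · simpa only [Fin.update_cons_zero] using hf.differentiableOn w h0 0

end Nice

/-- Lebesgue measure on the positive half line. -/
abbrev halfMeasure : Measure ℝ := volume.restrict (Set.Ioi 0)

theorem integrable_rpow_mul_exp {σ c : ℝ} (hσ : 0 < σ) (hc : 0 < c) :
    Integrable (fun x : ℝ => x ^ (σ - 1) * Real.exp (-(c * x))) halfMeasure := by
  have h := Real.integral_rpow_mul_exp_neg_mul_Ioi hσ hc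
  by_contra hn
  rw [integral_undef hn] at h
  have := mul_pos (Real.rpow_pos_of_pos (one_div_pos.2 hc) σ) (Real.Gamma_pos_of_pos hσ)
  linarith

theorem norm_cpow_mul_exp {σ x : ℝ} (hx : 0 < x) (L : ℂ) :
    ‖(x : ℂ) ^ ((σ : ℂ) - 1) * cexp (-(x * L))‖ = x ^ (σ - 1) * Real.exp (-(L.re * x)) := by
  rw [norm_mul, norm_cpow_eq_rpow_re_of_pos hx, norm_exp]
  simp [mul_comm]

theorem integrable_cpow_mul_exp {σ : ℝ} (hσ : 0 < σ) {L : ℂ} (hL : 0 < L.re) :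
    Integrable (fun x : ℝ => (x : ℂ) ^ ((σ : ℂ) - 1) * cexp (-(x * L))) halfMeasure := by
  refine (integrable_rpow_mul_exp hσ hL).mono' ?_ ?_
  · refine Measurable.aestronglyMeasurable ?_
    fun_prop
  · filter_upwards [ae_restrict_mem measurableSet_Ioi] with x hx
    exact (norm_cpow_mul_exp hx L).le

theorem integral_norm_cpow_mul_exp {σ : ℝ} (hσ : 0 < σ) {L : ℂ} (hL : 0 < L.re) :
    ∫ x, ‖(x : ℂ) ^ ((σ : ℂ) - 1) * cexp (-(x * L))‖ ∂halfMeasure =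
      L.re ^ (-σ) * Real.Gamma σ := by
  rw [Real.rpow_neg hL.le, ← Real.inv_rpow hL.le, ← one_div,
    ← Real.integral_rpow_mul_exp_neg_mul_Ioi hσ hL]
  refine setIntegral_congr_fun measurableSet_Ioi fun x hx => ?_
  exact norm_cpow_mul_exp hx L

theorem integral_cpow_mul_exp {σ : ℝ} (hσ : 0 < σ) {L : ℂ} (hL : 0 < L.re) :
    ∫ x, (x : ℂ) ^ ((σ : ℂ) - 1) * cexp (-(x * L)) ∂halfMeasure =
      L ^ (-(σ : ℂ)) * Gamma σ := by
  have hopen : IsOpen {z : ℂ | 0 < z.re} := isOpen_lt continuous_const continuous_re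
  have h1 : DifferentiableOn ℂ (fun L : ℂ =>
      ∫ x, (x : ℂ) ^ ((σ : ℂ) - 1) * cexp (-(x * L)) ∂halfMeasure) {z : ℂ | 0 < z.re} := by
    intro L hL
    have hW : IsOpen {z : ℂ | L.re / 2 < z.re} := isOpen_lt continuous_const continuous_re
    have hL' : 0 < L.re / 2 := half_pos hL
    have := differentiableOn_integral_of_bound hW
      (f := fun L (x : ℝ) => (x : ℂ) ^ ((σ : ℂ) - 1) * cexp (-(x * L)))
      (integrable_rpow_mul_exp hσ hL') ?_ ?_ ?_
    · exact (this.differentiableAt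
        (hW.mem_nhds (show L.re / 2 < L.re from half_lt_self hL))).differentiableWithinAt
    · exact fun z hz => (integrable_cpow_mul_exp hσ (hL'.trans hz)).aestronglyMeasurable
    · filter_upwards [ae_restrict_mem measurableSet_Ioi] with x hx z hz
      rw [norm_cpow_mul_exp hx]
      have hx' : (0 : ℝ) < x := hx
      have hz' : L.re / 2 < z.re := hz
      gcongr
    · refine Filter.Eventually.of_forall fun x => ?_
      fun_prop
  have h2 : DifferentiableOn ℂ (fun L : ℂ => L ^ (-(σ : ℂ)) * Gamma σ) {z : ℂ | 0 < z.re} := by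
    intro L hL
    refine DifferentiableWithinAt.mul_const ?_ _
    exact differentiableWithinAt_id.cpow_const (Or.inl hL)
  have hconv : IsPreconnected {z : ℂ | 0 < z.re} :=
    (convex_halfSpace_re_gt 0).isPreconnected
  refine AnalyticOnNhd.eqOn_of_preconnected_of_frequently_eq (h1.analyticOnNhd hopen)
    (h2.analyticOnNhd hopen) hconv (z₀ := 1) (by simp) ?_ hL
  have hu : Filter.Tendsto (fun k : ℕ => (1 : ℂ) + ((1 / ((k : ℝ) + 1) : ℝ) : ℂ)) Filter.atTop
      (nhdsWithin 1 {1}ᶜ) := by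
    rw [tendsto_nhdsWithin_iff]
    constructor
    · have h2 := (continuous_ofReal.tendsto 0).comp
        (tendsto_one_div_add_atTop_nhds_zero_nat (𝕜 := ℝ))
      simpa using! h2.const_add (1 : ℂ)
    · refine Filter.Eventually.of_forall fun k => ?_
      have : (1 / ((k : ℝ) + 1) : ℝ) ≠ 0 := by positivity
      simp only [Set.mem_compl_iff, Set.mem_singleton_iff, add_eq_left, ofReal_eq_zero]
      exact this
  refine hu.frequently (Filter.Frequently.of_forall fun k => ?_)
  have hr : 0 < 1 + 1 / ((k : ℝ) + 1) := by positivity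
  have := integral_cpow_mul_exp_neg_mul_Ioi (a := σ) (by simpa using hσ) hr
  push_cast at this ⊢
  rw [cpow_neg, ← inv_cpow, ← one_div, ← this]
  · refine integral_congr_ae (Filter.Eventually.of_forall fun x => ?_)
    simp only [mul_comm]
  · have h : (1 : ℂ) + 1 / ((k : ℂ) + 1) = ((1 + 1 / ((k : ℝ) + 1) : ℝ) : ℂ) := by push_cast; rfl
    rw [h, arg_ofReal_of_nonneg hr.le]
    exact Real.pi_pos.ne

/-- The measure `ν` and exponent `τ` have Laplace transform `Λ`, with `z * Λ z` holomorphic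
and equal to `b z` near the origin, where `b` has rational Taylor coefficients. -/
structure LaplaceKernel {T : Type*} [MeasurableSpace T] (ν : Measure T) (τ : T → ℝ)
    (Λ b : ℂ → ℂ) : Prop where
  measurable : Measurable τ
  nonneg : ∀ t, 0 ≤ τ t
  integrable : Integrable (fun t => ((1 + τ t) ^ 2)⁻¹) ν
  laplace : ∀ z : ℂ, 0 < z.re → ∫ t, cexp (-(τ t * z)) ∂ν = Λ z
  hol : DifferentiableOn ℂ Λ {z | 0 < z.re}
  bound : ∀ c : ℝ, 0 < c → ∃ C : ℝ, ∀ z : ℂ, c ≤ z.re → ‖Λ z‖ ≤ C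
  hol_b : DifferentiableOn ℂ b (Metric.ball 0 2)
  eq_b : ∀ z : ℂ, 0 < z.re → z ∈ Metric.ball (0 : ℂ) 2 → Λ z = b z * z⁻¹
  rat_b : ∀ j, ∃ q : ℚ, iteratedDeriv j b 0 = q

/-- The linear forms `w j + ∑ i, t i * a i j`. -/
def linForm {N n : ℕ} (a : Fin N → Fin n → ℂ) (w : Fin n → ℂ) (t : Fin N → ℝ) (j : Fin n) : ℂ :=
  w j + ∑ i, (t i : ℂ) * a i j

theorem HypH.re_nonneg {N n : ℕ} {a : Fin N → Fin n → ℂ} (hH : HypH a) (i : Fin N) (j : Fin n) :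
    0 ≤ (a i j).re := by
  rcases hH.1 i j with h | h
  · simp [h]
  · exact h.le

theorem HypH.exists_lower {N n : ℕ} {a : Fin N → Fin n → ℂ} (hH : HypH a) :
    ∃ c : ℝ, 0 < c ∧ ∀ i j, a i j ≠ 0 → c ≤ (a i j).re := by
  by_cases hne : (Finset.univ.filter fun p : Fin N × Fin n => a p.1 p.2 ≠ 0).Nonempty
  · obtain ⟨p, hp, hmin⟩ := Finset.exists_min_image _ (fun p : Fin N × Fin n => (a p.1 p.2).re) hne
    refine ⟨(a p.1 p.2).re, ?_, fun i j hij => hmin (i, j) (by simpa using hij)⟩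
    exact (hH.1 p.1 p.2).resolve_left (by simpa using hp)
  · refine ⟨1, one_pos, fun i j hij => absurd ⟨(i, j), ?_⟩ hne⟩
    simpa using hij

theorem exists_lower_re {n : ℕ} {w : Fin n → ℂ} (hw : ∀ j, 0 < (w j).re) :
    ∃ c : ℝ, 0 < c ∧ ∀ j, c ≤ (w j).re := by
  rcases isEmpty_or_nonempty (Fin n) with h | h
  · exact ⟨1, one_pos, fun j => h.elim j⟩
  · obtain ⟨j, -, hj⟩ := Finset.exists_min_image Finset.univ (fun j => (w j).re)
      Finset.univ_nonempty
    exact ⟨_, hw j, fun i => hj i (Finset.mem_univ _)⟩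

theorem linForm_re {N n : ℕ} (a : Fin N → Fin n → ℂ) (w : Fin n → ℂ) (t : Fin N → ℝ) (j : Fin n) :
    (linForm a w t j).re = (w j).re + ∑ i, t i * (a i j).re := by
  simp [linForm]

theorem linForm_re_pos {N n : ℕ} {a : Fin N → Fin n → ℂ} (hH : HypH a) {w : Fin n → ℂ}
    (hw : ∀ j, 0 < (w j).re) {t : Fin N → ℝ} (ht : ∀ i, 0 ≤ t i) (j : Fin n) :
    0 < (linForm a w t j).re := by
  rw [linForm_re]
  exact add_pos_of_pos_of_nonneg (hw j)
    (Finset.sum_nonneg fun i _ => mul_nonneg (ht i) (hH.re_nonneg i j))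

theorem exists_prod_rpow_bound {N n : ℕ} {a : Fin N → Fin n → ℂ} (hH : HypH a) {w : Fin n → ℂ}
    (hw : ∀ j, 0 < (w j).re) {σ : ℝ} (hσ : 2 * N ≤ σ) :
    ∃ C : ℝ, 0 ≤ C ∧ ∀ t : Fin N → ℝ, (∀ i, 0 ≤ t i) →
      ∏ j, (linForm a w t j).re ^ (-σ) ≤ C * ∏ i, ((1 + t i) ^ 2)⁻¹ := by
  obtain ⟨c₁, hc₁, hca⟩ := hH.exists_lower
  obtain ⟨c₂, hc₂, hcw⟩ := exists_lower_re hw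
  set c := min c₁ c₂ with hc
  have hc0 : 0 < c := lt_min hc₁ hc₂
  refine ⟨∏ _j : Fin n, c ^ (-σ), Finset.prod_nonneg fun _ _ => by positivity, fun t ht => ?_⟩
  have hℓ : ∀ j, c ≤ (linForm a w t j).re := fun j => by
    rw [linForm_re]
    have : 0 ≤ ∑ i, t i * (a i j).re :=
      Finset.sum_nonneg fun i _ => mul_nonneg (ht i) (hH.re_nonneg i j)
    have := hcw j
    have := min_le_right c₁ c₂
    linarith
  have hℓpos : ∀ j, 0 < (linForm a w t j).re := fun j => hc0.trans_le (hℓ j)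
  have hone : ∀ j, 1 ≤ (linForm a w t j).re / c := fun j => (one_le_div hc0).2 (hℓ j)
  set X := ∏ j, (linForm a w t j).re / c with hX
  have hX1 : 1 ≤ X := by
    rw [hX]
    exact Finset.prod_induction _ (fun x => 1 ≤ x) (fun x y => one_le_mul_of_one_le_of_one_le)
      le_rfl fun j _ => hone j
  have hti : ∀ i, 1 + t i ≤ X := by
    intro i
    obtain ⟨j, hj⟩ := hH.2 i
    have h1 : 1 + t i ≤ (linForm a w t j).re / c := by
      rw [le_div_iff₀ hc0, linForm_re]
      have h2 : t i * (a i j).re ≤ ∑ i, t i * (a i j).re :=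
        Finset.single_le_sum (f := fun i => t i * (a i j).re)
          (fun i _ => mul_nonneg (ht i) (hH.re_nonneg i j)) (Finset.mem_univ i)
      have h3 : t i * c ≤ t i * (a i j).re :=
        mul_le_mul_of_nonneg_left ((min_le_left _ _).trans (hca i j hj)) (ht i)
      have h4 := (min_le_right c₁ c₂).trans (hcw j)
      linarith
    refine h1.trans ?_
    rw [hX, ← Finset.mul_prod_erase _ _ (Finset.mem_univ j)]
    refine le_mul_of_one_le_right (zero_le_one.trans (hone j)) ?_
    exact Finset.prod_induction _ (fun x => 1 ≤ x) (fun x y => one_le_mul_of_one_le_of_one_le)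
      le_rfl fun j _ => hone j
  have hprod : ∏ i, (1 + t i) ^ 2 ≤ X ^ σ := by
    calc ∏ i, (1 + t i) ^ 2 ≤ ∏ _i : Fin N, X ^ 2 :=
          Finset.prod_le_prod (fun i _ => sq_nonneg _) fun i _ =>
            pow_le_pow_left₀ (by have := ht i; positivity) (hti i) 2
      _ = X ^ ((2 * N : ℕ) : ℝ) := by
          rw [Finset.prod_const, Finset.card_univ, Fintype.card_fin, ← pow_mul, Real.rpow_natCast]
      _ ≤ X ^ σ := Real.rpow_le_rpow_of_exponent_le hX1 (by push_cast; exact hσ)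
  have e : ∏ j, (linForm a w t j).re ^ (-σ) = (∏ _j : Fin n, c ^ (-σ)) * (X ^ σ)⁻¹ := by
    rw [← Real.rpow_neg (zero_le_one.trans hX1), hX,
      ← Real.finsetProd_rpow _ _ fun j _ => zero_le_one.trans (hone j), ← Finset.prod_mul_distrib]
    refine Finset.prod_congr rfl fun j _ => ?_
    rw [← Real.mul_rpow hc0.le (zero_le_one.trans (hone j)), mul_div_cancel₀ _ hc0.ne']
  rw [e, Finset.prod_inv_distrib]
  have hpos : 0 < ∏ i, (1 + t i) ^ 2 := Finset.prod_pos fun i _ => by have := ht i; positivity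
  have : 0 ≤ ∏ _j : Fin n, c ^ (-σ) := Finset.prod_nonneg fun _ _ => by positivity
  gcongr

/-- The integrand of the Mellin representation. -/
def mellinIntegrand {N n : ℕ} (a : Fin N → Fin n → ℂ) (w : Fin n → ℂ) (Λ : ℂ → ℂ) (s : ℂ)
    (x : Fin n → ℝ) : ℂ :=
  (∏ j, (x j : ℂ) ^ (s - 1)) * cexp (-∑ j, w j * x j) * ∏ i, Λ (∑ j, a i j * x j)

section

variable {T : Type*} [MeasurableSpace T] {ν : Measure T} {τ : T → ℝ}
  {Λ b : ℂ → ℂ} {N n : ℕ} {a : Fin N → Fin n → ℂ} {w : Fin n → ℂ} {σ : ℝ}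

theorem LaplaceKernel.measurable_linForm (h : LaplaceKernel ν τ Λ b) (j : Fin n) :
    Measurable fun t : Fin N → T => linForm a w (fun i => τ (t i)) j := by
  have := h.measurable
  unfold linForm
  fun_prop

theorem LaplaceKernel.integrable_prod_cpow [SigmaFinite ν] (h : LaplaceKernel ν τ Λ b) (hH : HypH a)
    (hw : ∀ j, 0 < (w j).re) (hσ : 2 * N ≤ σ) :
    Integrable (fun t : Fin N → T => ∏ j, (linForm a w (fun i => τ (t i)) j) ^ (-(σ : ℂ)))
      (Measure.pi fun _ => ν) := by
  obtain ⟨C, hC, hb⟩ := exists_prod_rpow_bound hH hw hσ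
  have hi : Integrable (fun t : Fin N → T => ∏ i, ((1 + τ (t i)) ^ 2)⁻¹)
      (Measure.pi fun _ => ν) := Integrable.fintype_prod fun _ => h.integrable
  refine (hi.const_mul C).mono' ?_ (Filter.Eventually.of_forall fun t => ?_)
  · refine Measurable.aestronglyMeasurable ?_
    exact Finset.measurable_fun_prod _ fun j _ => (h.measurable_linForm j).pow_const _
  · refine le_trans ?_ (hb _ fun i => h.nonneg (t i))
    rw [norm_prod]
    refine Finset.prod_le_prod (fun _ _ => norm_nonneg _) fun j _ => ?_
    have hpos := linForm_re_pos hH hw (fun i => h.nonneg (t i)) j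
    have hne : linForm a w (fun i => τ (t i)) j ≠ 0 := by
      intro h0; rw [h0] at hpos; simp at hpos
    rw [← ofReal_neg, norm_cpow_of_ne_zero hne]
    simp only [ofReal_re, ofReal_im, mul_zero, Real.exp_zero, div_one]
    refine Real.rpow_le_rpow_of_nonpos hpos (re_le_norm _) ?_
    have : (0 : ℝ) ≤ N := Nat.cast_nonneg _
    linarith

theorem ae_pi_halfMeasure_pos (n : ℕ) :
    ∀ᵐ x ∂(Measure.pi fun _ : Fin n => halfMeasure), ∀ j, 0 < x j := by
  refine ae_all_iff.2 fun j => ?_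
  exact (Measure.tendsto_eval_ae_ae (μ := fun _ : Fin n => halfMeasure)).eventually
    (ae_restrict_mem measurableSet_Ioi)

theorem HypH.re_sum_pos (hH : HypH a) {x : Fin n → ℝ} (hx : ∀ j, 0 < x j) (i : Fin N) :
    0 < (∑ j, a i j * x j).re := by
  simp only [re_sum, re_mul_ofReal]
  obtain ⟨j, hj⟩ := hH.2 i
  refine Finset.sum_pos' (fun j _ => mul_nonneg (hH.re_nonneg i j) (hx j).le)
    ⟨j, Finset.mem_univ j, mul_pos ((hH.1 i j).resolve_left hj) (hx j)⟩

/-- The integrand whose two iterated integrals give the Mellin representation. -/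
def doubleIntegrand (a : Fin N → Fin n → ℂ) (w : Fin n → ℂ) (τ : T → ℝ) (σ : ℝ)
    (p : (Fin N → T) × (Fin n → ℝ)) : ℂ :=
  ∏ j, ((p.2 j : ℂ) ^ ((σ : ℂ) - 1) * cexp (-(p.2 j * linForm a w (fun i => τ (p.1 i)) j)))

theorem LaplaceKernel.integrable_doubleIntegrand [SigmaFinite ν] (h : LaplaceKernel ν τ Λ b)
    (hH : HypH a) (hw : ∀ j, 0 < (w j).re) (hσ0 : 0 < σ) (hσ : 2 * N ≤ σ) :
    Integrable (doubleIntegrand a w τ σ)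
      ((Measure.pi fun _ => ν).prod (Measure.pi fun _ => halfMeasure)) := by
  have hm : AEStronglyMeasurable (doubleIntegrand a w τ σ)
      ((Measure.pi fun _ => ν).prod (Measure.pi fun _ => halfMeasure)) := by
    refine Measurable.aestronglyMeasurable ?_
    refine Finset.measurable_fun_prod _ fun j _ => ?_
    have h1 : Measurable fun p : (Fin N → T) × (Fin n → ℝ) =>
        linForm a w (fun i => τ (p.1 i)) j := (h.measurable_linForm j).comp measurable_fst
    have h2 : Measurable fun p : (Fin N → T) × (Fin n → ℝ) => (p.2 j : ℂ) := by fun_prop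
    exact (h2.pow_const _).mul (h2.mul h1).neg.cexp
  have hpos : ∀ (t : Fin N → T) j, 0 < (linForm a w (fun i => τ (t i)) j).re := fun t j =>
    linForm_re_pos hH hw (fun i => h.nonneg (t i)) j
  refine (integrable_prod_iff hm).2 ⟨Filter.Eventually.of_forall fun t => ?_, ?_⟩
  · exact Integrable.fintype_prod (f := fun j (x : ℝ) => (x : ℂ) ^ ((σ : ℂ) - 1) *
      cexp (-(x * linForm a w (fun i => τ (t i)) j)))
        fun j => integrable_cpow_mul_exp hσ0 (hpos t j)
  · obtain ⟨C, hC, hb⟩ := exists_prod_rpow_bound hH hw hσ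
    have hi : Integrable (fun t : Fin N → T => ∏ i, ((1 + τ (t i)) ^ 2)⁻¹)
        (Measure.pi fun _ => ν) := Integrable.fintype_prod fun _ => h.integrable
    refine ((hi.const_mul C).mul_const (∏ _j : Fin n, Real.Gamma σ)).mono'
      hm.norm.integral_prod_right' (Filter.Eventually.of_forall fun t => ?_)
    have e : ∫ x, ‖doubleIntegrand a w τ σ (t, x)‖ ∂(Measure.pi fun _ => halfMeasure) =
        (∏ j, (linForm a w (fun i => τ (t i)) j).re ^ (-σ)) * ∏ _j : Fin n, Real.Gamma σ := by
      simp only [doubleIntegrand, norm_prod]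
      rw [integral_fintype_prod_eq_prod (fun j (x : ℝ) => ‖(x : ℂ) ^ ((σ : ℂ) - 1) *
        cexp (-(x * linForm a w (fun i => τ (t i)) j))‖), ← Finset.prod_mul_distrib]
      exact Finset.prod_congr rfl fun j _ => integral_norm_cpow_mul_exp hσ0 (hpos t j)
    have hΓ : 0 ≤ ∏ _j : Fin n, Real.Gamma σ :=
      Finset.prod_nonneg fun _ _ => (Real.Gamma_pos_of_pos hσ0).le
    rw [e, Real.norm_of_nonneg]
    · exact mul_le_mul_of_nonneg_right (hb _ fun i => h.nonneg (t i)) hΓ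
    · exact mul_nonneg (Finset.prod_nonneg fun j _ => Real.rpow_nonneg (hpos t j).le _) hΓ

theorem LaplaceKernel.integral_doubleIntegrand [SigmaFinite ν] (h : LaplaceKernel ν τ Λ b)
    (hH : HypH a) {x : Fin n → ℝ} (hx : ∀ j, 0 < x j) :
    ∫ t, doubleIntegrand a w τ σ (t, x) ∂(Measure.pi fun _ => ν) = mellinIntegrand a w Λ σ x := by
  have e : ∀ t : Fin N → T, doubleIntegrand a w τ σ (t, x) =
      ((∏ j, (x j : ℂ) ^ ((σ : ℂ) - 1)) * cexp (-∑ j, w j * x j)) *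
        ∏ i, cexp (-(τ (t i) * ∑ j, a i j * x j)) := by
    intro t
    simp only [doubleIntegrand]
    rw [Finset.prod_mul_distrib, mul_assoc, ← Complex.exp_sum, ← Complex.exp_sum, ← Complex.exp_add]
    congr 2
    simp only [linForm, Finset.sum_neg_distrib, Finset.mul_sum, mul_add, Finset.sum_add_distrib]
    rw [Finset.sum_comm, neg_add]
    congr 2
    · exact Finset.sum_congr rfl fun j _ => mul_comm _ _
    · exact Finset.sum_congr rfl fun i _ => Finset.sum_congr rfl fun j _ => by ring
  simp only [e]
  rw [integral_const_mul,
    integral_fintype_prod_eq_prod (fun i (t : T) => cexp (-(τ t * ∑ j, a i j * x j))),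
    mellinIntegrand]
  congr 1
  exact Finset.prod_congr rfl fun i _ => h.laplace _ (hH.re_sum_pos hx i)

theorem LaplaceKernel.integrable_mellinIntegrand [SigmaFinite ν] (h : LaplaceKernel ν τ Λ b)
    (hH : HypH a) (hw : ∀ j, 0 < (w j).re) (hσ0 : 0 < σ) (hσ : 2 * N ≤ σ) :
    Integrable (mellinIntegrand a w Λ σ) (Measure.pi fun _ => halfMeasure) := by
  refine (h.integrable_doubleIntegrand hH hw hσ0 hσ).integral_prod_right.congr ?_
  filter_upwards [ae_pi_halfMeasure_pos n] with x hx
  exact h.integral_doubleIntegrand hH hx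

theorem LaplaceKernel.integral_mellinIntegrand [SigmaFinite ν] (h : LaplaceKernel ν τ Λ b)
    (hH : HypH a) (hw : ∀ j, 0 < (w j).re) (hσ0 : 0 < σ) (hσ : 2 * N ≤ σ) :
    ∫ x, mellinIntegrand a w Λ σ x ∂(Measure.pi fun _ => halfMeasure) =
      Gamma σ ^ n * ∫ t, ∏ j, (linForm a w (fun i => τ (t i)) j) ^ (-(σ : ℂ))
        ∂(Measure.pi fun _ : Fin N => ν) := by
  have hi := h.integrable_doubleIntegrand hH hw hσ0 hσ
  have h1 := integral_prod _ hi
  rw [integral_prod_symm _ hi] at h1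
  rw [← integral_const_mul]
  refine Eq.trans ?_ (h1.trans ?_)
  · refine integral_congr_ae ?_
    filter_upwards [ae_pi_halfMeasure_pos n] with x hx
    exact (h.integral_doubleIntegrand hH hx).symm
  · refine integral_congr_ae (Filter.Eventually.of_forall fun t => ?_)
    simp only [doubleIntegrand]
    rw [integral_fintype_prod_eq_prod (fun j (x : ℝ) => (x : ℂ) ^ ((σ : ℂ) - 1) *
      cexp (-(x * linForm a w (fun i => τ (t i)) j))),
      Finset.prod_congr rfl fun j _ => integral_cpow_mul_exp hσ0
        (linForm_re_pos hH hw (fun i => h.nonneg (t i)) j), Finset.prod_mul_distrib,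
      Finset.prod_const, Finset.card_univ, Fintype.card_fin, mul_comm]

end

/-- The cumulative products `u 0 * u 1 * ⋯ * u k`. -/
def cumProd {R : Type*} [CommMonoid R] {r : ℕ} (u : Fin r → R) (k : Fin r) : R :=
  ∏ i, if i ≤ k then u i else 1

theorem cumProd_cons_zero {R : Type*} [CommMonoid R] {r : ℕ} (t : R) (u : Fin r → R) :
    cumProd (Fin.cons t u : Fin (r + 1) → R) 0 = t := by
  simp [cumProd]

theorem cumProd_cons_succ {R : Type*} [CommMonoid R] {r : ℕ} (t : R) (u : Fin r → R) (k : Fin r) :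
    cumProd (Fin.cons t u : Fin (r + 1) → R) k.succ = t * cumProd u k := by
  simp [cumProd, Fin.prod_univ_succ]

theorem measurable_cumProd {r : ℕ} : Measurable (cumProd : (Fin r → ℝ) → Fin r → ℝ) := by
  refine measurable_pi_lambda _ fun k => Finset.measurable_fun_prod _ fun i _ => ?_
  by_cases h : i ≤ k <;> simp only [h, if_true, if_false] <;> fun_prop

theorem pi_unitMeasure_eq (r : ℕ) :
    (Measure.pi fun _ : Fin r => unitMeasure) =
      volume.restrict (Set.univ.pi fun _ : Fin r => Set.Ioc (0 : ℝ) 1) := by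
  rw [volume_pi, Measure.restrict_pi_pi]

theorem lintegral_unit_scale {r : ℕ} {g : (Fin r → ℝ) → ENNReal} (hg : Measurable g) {t : ℝ}
    (ht : t ∈ Set.Ioc (0 : ℝ) 1) :
    ∫⁻ y, {y : Fin r → ℝ | ∀ k, y k ≤ t}.indicator g y ∂(Measure.pi fun _ => unitMeasure) =
      ENNReal.ofReal (t ^ r) * ∫⁻ y, g (t • y) ∂(Measure.pi fun _ => unitMeasure) := by
  have hm : ∀ t : ℝ, MeasurableSet {y : Fin r → ℝ | ∀ k, y k ≤ t} := fun t => by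
    rw [Set.ofPred_forall]
    exact MeasurableSet.iInter fun k => measurableSet_le (measurable_pi_apply k) measurable_const
  have hbox : MeasurableSet (Set.univ.pi fun _ : Fin r => Set.Ioc (0 : ℝ) 1) :=
    MeasurableSet.univ_pi fun _ => measurableSet_Ioc
  have hbox' : MeasurableSet (Set.univ.pi fun _ : Fin r => Set.Ioc (0 : ℝ) t) :=
    MeasurableSet.univ_pi fun _ => measurableSet_Ioc
  rw [pi_unitMeasure_eq, ← lintegral_indicator hbox, ← lintegral_indicator hbox]
  have e1 : ∀ y : Fin r → ℝ, (Set.univ.pi fun _ : Fin r => Set.Ioc (0 : ℝ) 1).indicator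
      ({y : Fin r → ℝ | ∀ k, y k ≤ t}.indicator g) y =
        (Set.univ.pi fun _ : Fin r => Set.Ioc (0 : ℝ) t).indicator g y := by
    intro y
    rw [Set.indicator_indicator]
    congr 1
    ext y
    simp only [Set.mem_inter_iff, Set.mem_univ_pi, Set.mem_Ioc, Set.mem_ofPred_eq, ← forall_and]
    refine forall_congr' fun k => ⟨fun h => ⟨h.1.1, h.2⟩, fun h => ⟨⟨h.1, h.2.trans ht.2⟩, h.2⟩⟩
  have e2 : ∀ y : Fin r → ℝ, (Set.univ.pi fun _ : Fin r => Set.Ioc (0 : ℝ) 1).indicator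
      (fun y => g (t • y)) y =
        (Set.univ.pi fun _ : Fin r => Set.Ioc (0 : ℝ) t).indicator g (t • y) := by
    intro y
    simp only [Set.indicator]
    congr 1
    simp only [Set.mem_univ_pi, Set.mem_Ioc, Pi.smul_apply, smul_eq_mul]
    refine propext (forall_congr' fun k => and_congr ?_ ?_)
    · exact (mul_pos_iff_of_pos_left ht.1).symm
    · exact (mul_le_iff_le_one_right ht.1).symm
  simp only [e1, e2]
  rw [← lintegral_map (μ := (volume : Measure (Fin r → ℝ)))
      (f := (Set.univ.pi fun _ : Fin r => Set.Ioc (0 : ℝ) t).indicator g) (hg.indicator hbox')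
      (measurable_const_smul t), Measure.map_addHaar_smul _ ht.1.ne', lintegral_smul_measure,
    smul_eq_mul, ← mul_assoc, ← ENNReal.ofReal_mul (pow_nonneg ht.1.le _)]
  have : t ^ r * |(t ^ Module.finrank ℝ (Fin r → ℝ))⁻¹| = 1 := by
    have := pow_pos ht.1 r
    rw [Module.finrank_fin_fun, abs_of_pos (inv_pos.2 this), mul_inv_cancel₀ this.ne']
  rw [this, ENNReal.ofReal_one, one_mul]

theorem measurableSet_antitone (r : ℕ) : MeasurableSet {x : Fin r → ℝ | Antitone x} := by
  have : {x : Fin r → ℝ | Antitone x} = ⋂ i, ⋂ j, ⋂ (_ : i ≤ j), {x | x j ≤ x i} := by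
    ext x
    simp [Antitone]
  rw [this]
  exact MeasurableSet.iInter fun i => MeasurableSet.iInter fun j => MeasurableSet.iInter fun _ =>
    measurableSet_le (measurable_pi_apply j) (measurable_pi_apply i)

theorem antitone_cons_iff {r : ℕ} {t : ℝ} {y : Fin r → ℝ} :
    Antitone (Fin.cons t y : Fin (r + 1) → ℝ) ↔ (∀ k, y k ≤ t) ∧ Antitone y := by
  constructor
  · intro h
    refine ⟨fun k => by simpa using h (Fin.zero_le k.succ), fun i j hij => ?_⟩
    simpa using h (Fin.succ_le_succ_iff.2 hij)
  · rintro ⟨h1, h2⟩ i j hij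
    induction i using Fin.cases with
    | zero =>
      induction j using Fin.cases with
      | zero => simp
      | succ j => simpa using h1 j
    | succ i =>
      induction j using Fin.cases with
      | zero => exact absurd hij (by simp)
      | succ j => simpa using h2 (Fin.succ_le_succ_iff.1 hij)

theorem measurable_cons {r : ℕ} : Measurable fun p : ℝ × (Fin r → ℝ) =>
    (Fin.cons p.1 p.2 : Fin (r + 1) → ℝ) := by
  refine measurable_pi_lambda _ fun k => ?_
  refine Fin.cases ?_ (fun i => ?_) k
  · simpa using measurable_fst
  · simp only [Fin.cons_succ]
    exact (measurable_pi_apply i).comp measurable_snd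

theorem lintegral_pi_unit_succ {r : ℕ} {F : (Fin (r + 1) → ℝ) → ENNReal} (hF : Measurable F) :
    ∫⁻ x, F x ∂(Measure.pi fun _ => unitMeasure) =
      ∫⁻ t, ∫⁻ y, F (Fin.cons t y) ∂(Measure.pi fun _ => unitMeasure) ∂unitMeasure := by
  have hF' : Measurable fun p : ℝ × (Fin r → ℝ) => F (Fin.cons p.1 p.2) := hF.comp measurable_cons
  rw [← (measurePreserving_cons_unit r).lintegral_comp hF, ← lintegral_prod _ hF'.aemeasurable]
  refine lintegral_congr fun p => congrArg F ?_
  funext k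
  refine Fin.cases ?_ (fun i => ?_) k <;> simp [MeasurableEquiv.piFinSuccAbove]

theorem prod_pow_cons {r : ℕ} (t : ℝ) (u : Fin r → ℝ) :
    ∏ k : Fin (r + 1), (Fin.cons t u : Fin (r + 1) → ℝ) k ^ (r + 1 - 1 - (k : ℕ)) =
      t ^ r * ∏ k : Fin r, u k ^ (r - 1 - (k : ℕ)) := by
  rw [Fin.prod_univ_succ]
  congr 1
  refine Finset.prod_congr rfl fun k _ => ?_
  have : r + 1 - 1 - (k.succ : ℕ) = r - 1 - (k : ℕ) := by simp; omega
  rw [this, Fin.cons_succ]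

theorem measurable_prod_pow (r : ℕ) :
    Measurable fun u : Fin r → ℝ => ENNReal.ofReal (∏ k : Fin r, u k ^ (r - 1 - (k : ℕ))) := by
  fun_prop

theorem lintegral_antitone {r : ℕ} {f : (Fin r → ℝ) → ENNReal} (hf : Measurable f) :
    ∫⁻ x, {x : Fin r → ℝ | Antitone x}.indicator f x ∂(Measure.pi fun _ => unitMeasure) =
      ∫⁻ u, ENNReal.ofReal (∏ k : Fin r, u k ^ (r - 1 - (k : ℕ))) * f (cumProd u)
        ∂(Measure.pi fun _ => unitMeasure) := by
  induction r with
  | zero =>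
    refine lintegral_congr fun u => ?_
    have h1 : u ∈ {x : Fin 0 → ℝ | Antitone x} := fun i => i.elim0
    rw [Set.indicator_of_mem h1]
    simp only [Finset.univ_eq_empty, Finset.prod_empty, ENNReal.ofReal_one, one_mul]
    exact congrArg f (Subsingleton.elim _ _)
  | succ r ih =>
    rw [lintegral_pi_unit_succ (hf.indicator (measurableSet_antitone _)),
      lintegral_pi_unit_succ
        (F := fun u => ENNReal.ofReal (∏ k : Fin (r + 1), u k ^ (r + 1 - 1 - (k : ℕ))) *
          f (cumProd u)) ((measurable_prod_pow _).mul (hf.comp measurable_cumProd))]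
    refine setLIntegral_congr_fun measurableSet_Ioc fun t ht => ?_
    have hft : Measurable fun y : Fin r → ℝ => f (Fin.cons t y) :=
      hf.comp (measurable_cons.comp measurable_prodMk_left)
    have e1 : ∀ y : Fin r → ℝ, {x : Fin (r + 1) → ℝ | Antitone x}.indicator f (Fin.cons t y) =
        {y : Fin r → ℝ | ∀ k, y k ≤ t}.indicator
          ({y : Fin r → ℝ | Antitone y}.indicator fun y => f (Fin.cons t y)) y := by
      intro y
      rw [Set.indicator_indicator]
      simp only [Set.indicator, Set.mem_ofPred_eq, antitone_cons_iff, Set.mem_inter_iff]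
    have e2 : ∀ y : Fin r → ℝ, ({y : Fin r → ℝ | Antitone y}.indicator fun y => f (Fin.cons t y))
        (t • y) = {y : Fin r → ℝ | Antitone y}.indicator (fun y => f (Fin.cons t (t • y))) y := by
      intro y
      simp only [Set.indicator, Set.mem_ofPred_eq]
      congr 1
      refine propext ⟨fun h i j hij => ?_, fun h i j hij => ?_⟩
      · exact le_of_mul_le_mul_left (h hij) ht.1
      · exact mul_le_mul_of_nonneg_left (h hij) ht.1.le
    simp only [e1]
    rw [lintegral_unit_scale (hft.indicator (measurableSet_antitone _)) ht]
    simp only [e2]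
    have ih' := ih (f := fun y => f (Fin.cons t (t • y))) (hft.comp (measurable_const_smul t))
    rw [ih']
    refine (lintegral_const_mul _ ((measurable_prod_pow _).mul
      ((hft.comp (measurable_const_smul t)).comp measurable_cumProd))).symm.trans ?_
    refine lintegral_congr fun u => ?_
    simp only [Pi.mul_apply, Function.comp_apply]
    rw [prod_pow_cons, ENNReal.ofReal_mul (pow_nonneg ht.1.le _), mul_assoc]
    congr 3
    funext k
    refine Fin.cases ?_ (fun i => ?_) k
    · simp [cumProd_cons_zero]
    · simp [cumProd_cons_succ]

theorem ae_injective (r : ℕ) :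
    ∀ᵐ x ∂(Measure.pi fun _ : Fin r => unitMeasure), Function.Injective x := by
  have key : ∀ i j : Fin r, i ≠ j →
      ∀ᵐ x ∂(Measure.pi fun _ : Fin r => unitMeasure), x i ≠ x j := by
    intro i j hij
    rw [pi_unitMeasure_eq]
    refine ae_restrict_of_ae ?_
    have h := Measure.addHaar_submodule (volume : Measure (Fin r → ℝ))
      (LinearMap.ker ((LinearMap.proj i : (Fin r → ℝ) →ₗ[ℝ] ℝ) - LinearMap.proj j)) (by
        intro h
        have : (Pi.single i 1 : Fin r → ℝ) ∈
          LinearMap.ker ((LinearMap.proj i : (Fin r → ℝ) →ₗ[ℝ] ℝ) - LinearMap.proj j) := by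
            rw [h]; trivial
        simp [hij.symm] at this)
    rw [ae_iff]
    convert h using 2
    ext x
    simp [sub_eq_zero]
  have : ∀ᵐ x ∂(Measure.pi fun _ : Fin r => unitMeasure), ∀ i j : Fin r, i ≠ j → x i ≠ x j := by
    refine ae_all_iff.2 fun i => ae_all_iff.2 fun j => ?_
    by_cases h : i = j
    · exact Filter.Eventually.of_forall fun x hx => absurd h hx
    · filter_upwards [key i j h] with x hx _ using hx
  filter_upwards [this] with x hx i j hij
  by_contra h
  exact hx i j h hij

theorem sum_indicator_antitone {r : ℕ} {x : Fin r → ℝ} (hx : Function.Injective x) (c : ENNReal) :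
    ∑ σ : Equiv.Perm (Fin r), (if Antitone (x ∘ σ) then c else 0) = c := by
  have hex : Antitone (x ∘ Tuple.sort (OrderDual.toDual ∘ x)) := by
    intro i j hij
    exact Tuple.monotone_sort (OrderDual.toDual ∘ x) hij
  rw [Finset.sum_eq_single (Tuple.sort (OrderDual.toDual ∘ x)), if_pos hex]
  · intro σ _ hσ
    rw [if_neg]
    intro h
    apply hσ
    have hs : ∀ τ : Equiv.Perm (Fin r), Antitone (x ∘ τ) → StrictMono (OrderDual.toDual ∘ x ∘ τ) :=
      fun τ hτ => Monotone.strictMono_of_injective (fun i j hij => hτ hij)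
        (OrderDual.toDual.injective.comp (hx.comp τ.injective))
    have := (StrictMono.range_inj (hs _ h) (hs _ hex)).1 (by
      simp only [Set.range_comp, Equiv.range_eq_univ])
    ext i
    have h2 := congrFun this i
    exact congrArg Fin.val (hx (OrderDual.toDual.injective h2))
  · simp

theorem lintegral_unit_sort {r : ℕ} {f : (Fin r → ℝ) → ENNReal} (hf : Measurable f) :
    ∫⁻ x, f x ∂(Measure.pi fun _ => unitMeasure) = ∑ σ : Equiv.Perm (Fin r),
      ∫⁻ u, ENNReal.ofReal (∏ k : Fin r, u k ^ (r - 1 - (k : ℕ))) *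
        f (fun j => cumProd u (σ.symm j)) ∂(Measure.pi fun _ => unitMeasure) := by
  have hre : ∀ σ : Equiv.Perm (Fin r), Measurable fun x : Fin r → ℝ => fun k => x (σ k) :=
    fun σ => measurable_pi_lambda _ fun k => measurable_pi_apply _
  have e : ∀ σ : Equiv.Perm (Fin r),
      ∫⁻ u, ENNReal.ofReal (∏ k : Fin r, u k ^ (r - 1 - (k : ℕ))) *
        f (fun j => cumProd u (σ.symm j)) ∂(Measure.pi fun _ => unitMeasure) =
      ∫⁻ x : Fin r → ℝ, (if Antitone (x ∘ σ) then f x else 0)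
        ∂(Measure.pi fun _ => unitMeasure) := by
    intro σ
    refine (lintegral_antitone (hf.comp (hre σ.symm))).symm.trans ?_
    have hmp : MeasurePreserving (fun x : Fin r → ℝ => fun k => x (σ k))
        (Measure.pi fun _ => unitMeasure) (Measure.pi fun _ => unitMeasure) := by
      have := measurePreserving_arrowCongr' (fun _ : Fin r => unitMeasure)
        (fun _ : Fin r => unitMeasure) σ.symm (MeasurableEquiv.refl ℝ)
        (fun _ => MeasurePreserving.id _)
      exact this
    rw [← hmp.lintegral_comp ((hf.comp (hre σ.symm)).indicator (measurableSet_antitone r))]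
    refine lintegral_congr fun x => ?_
    simp only [Set.indicator, Set.mem_ofPred_eq, Function.comp_def, Equiv.apply_symm_apply]
  simp only [e]
  rw [← lintegral_finsetSum]
  · refine lintegral_congr_ae ?_
    filter_upwards [ae_injective r] with x hx
    exact (sum_indicator_antitone hx (f x)).symm
  · intro σ _
    exact Measurable.ite ((hre σ) (measurableSet_antitone r)) hf measurable_const

/-- Lebesgue measure on `(1, ∞)`. -/
abbrev tailMeasure : Measure ℝ := volume.restrict (Set.Ioi 1)

theorem halfMeasure_eq_add : halfMeasure = unitMeasure + tailMeasure := by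
  rw [← Measure.restrict_union (by simp) measurableSet_Ioi, Set.Ioc_union_Ioi_eq_Ioi zero_le_one]

/-- Lebesgue measure on `(1, ∞)` for the indices in `S`, and on `(0, 1]` for the others. -/
def splitMeasure {n : ℕ} (S : Finset (Fin n)) (j : Fin n) : Measure ℝ :=
  if j ∈ S then tailMeasure else unitMeasure

instance sigmaFinite_splitMeasure {n : ℕ} (S : Finset (Fin n)) (j : Fin n) :
    SigmaFinite (splitMeasure S j) := by
  unfold splitMeasure
  split_ifs <;> infer_instance

theorem pi_halfMeasure_eq_sum (n : ℕ) : (Measure.pi fun _ : Fin n => halfMeasure) =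
    ∑ S : Finset (Fin n), Measure.pi (splitMeasure S) := by
  refine Measure.pi_eq fun s _ => ?_
  rw [Measure.finsetSum_apply]
  simp only [halfMeasure_eq_add, Measure.add_apply, add_comm (unitMeasure _)]
  rw [Finset.prod_add, Finset.powerset_univ]
  refine Finset.sum_congr rfl fun S _ => ?_
  rw [Measure.pi_pi, ← Finset.prod_mul_prod_compl S]
  congr 1
  · exact Finset.prod_congr rfl fun j hj => by rw [splitMeasure, if_pos hj]
  · rw [← Finset.compl_eq_univ_sdiff]
    exact Finset.prod_congr rfl fun j hj => by rw [splitMeasure, if_neg (Finset.mem_compl.1 hj)]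

/-- The point of the positive orthant with coordinates `p` on `S`, and with the cumulative
products of `u`, ordered by `e`, off `S`. -/
def pieceMap {n r : ℕ} (S : Finset (Fin n)) (e : Fin r ≃ {j // j ∉ S})
    (q : ({j // j ∈ S} → ℝ) × (Fin r → ℝ)) (j : Fin n) : ℝ :=
  if h : j ∈ S then q.1 ⟨j, h⟩ else cumProd q.2 (e.symm ⟨j, h⟩)

theorem measurable_pieceMap {n r : ℕ} (S : Finset (Fin n)) (e : Fin r ≃ {j // j ∉ S}) :
    Measurable (pieceMap S e) := by
  refine measurable_pi_lambda _ fun j => ?_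
  by_cases h : j ∈ S
  · simp only [pieceMap, h, dif_pos]
    exact (measurable_pi_apply _).comp measurable_fst
  · simp only [pieceMap, h, dif_neg, not_false_eq_true]
    exact (measurable_pi_apply _).comp (measurable_cumProd.comp measurable_snd)

/-- The measure on the parameters of a piece. -/
abbrev pieceMeasure {n : ℕ} (S : Finset (Fin n)) (r : ℕ) :
    Measure (({j // j ∈ S} → ℝ) × (Fin r → ℝ)) :=
  (Measure.pi fun _ => tailMeasure).prod (Measure.pi fun _ => unitMeasure)

theorem measurable_prod_pow_snd {α : Type*} [MeasurableSpace α] (r : ℕ) :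
    Measurable fun q : α × (Fin r → ℝ) =>
      ENNReal.ofReal (∏ k : Fin r, q.2 k ^ (r - 1 - (k : ℕ))) :=
  (measurable_prod_pow r).comp measurable_snd

theorem lintegral_pi_ite {n : ℕ} (S : Finset (Fin n)) {r : ℕ} (ε : Fin r ≃ {j // j ∉ S})
    {f : (Fin n → ℝ) → ENNReal} (hf : Measurable f) :
    ∫⁻ x, f x ∂(Measure.pi (splitMeasure S)) =
      ∑ σ : Equiv.Perm (Fin r), ∫⁻ q, ENNReal.ofReal (∏ k : Fin r, q.2 k ^ (r - 1 - (k : ℕ))) *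
        f (pieceMap S (σ.trans ε) q) ∂(pieceMeasure S r) := by
  set g : ({j // j ∈ S} → ℝ) × (Fin r → ℝ) → (Fin n → ℝ) := fun q j =>
    if h : j ∈ S then q.1 ⟨j, h⟩ else q.2 (ε.symm ⟨j, h⟩) with hg
  have hmg : MeasurePreserving g (pieceMeasure S r)
      (Measure.pi (splitMeasure S)) := by
    have h1 := (measurePreserving_piEquivPiSubtypeProd
      (splitMeasure S) (· ∈ S)).symm
    have h2 := measurePreserving_arrowCongr' (fun _ : Fin r => unitMeasure)
        (fun _ : {j // j ∉ S} => unitMeasure) ε (MeasurableEquiv.refl ℝ)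
        (fun _ => MeasurePreserving.id _)
    have h3 := (MeasurePreserving.id (Measure.pi fun _ : {j // j ∈ S} => tailMeasure)).prod h2
    have e3 : ∀ inst : Fintype {j // j ∈ S},
        @Measure.pi _ _ inst _ (fun i : {j // j ∈ S} => splitMeasure S i) =
          @Measure.pi _ _ (Finset.Subtype.fintype S) _ fun _ => tailMeasure := by
      intro inst
      cases Subsingleton.elim inst (Finset.Subtype.fintype S)
      refine Measure.pi_eq fun s _ => ?_
      rw [Measure.pi_pi]
      exact Finset.prod_congr rfl fun i _ => by rw [splitMeasure, if_pos i.2]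
    have e4 : ∀ inst : Fintype {j // ¬ j ∈ S},
        @Measure.pi _ _ inst _ (fun i : {j // ¬ j ∈ S} => splitMeasure S i) =
          Measure.pi fun _ => unitMeasure := by
      intro inst
      cases Subsingleton.elim inst inferInstance
      refine Measure.pi_eq fun s _ => ?_
      rw [Measure.pi_pi]
      exact Finset.prod_congr rfl fun i _ => by rw [splitMeasure, if_neg i.2]
    rw [e3, e4] at h1
    exact h1.comp h3
  have hgf : Measurable fun q => f (g q) := hf.comp hmg.measurable
  rw [← hmg.lintegral_comp hf, lintegral_prod _ hgf.aemeasurable]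
  have hJ : ∀ σ : Equiv.Perm (Fin r), Measurable fun q : ({j // j ∈ S} → ℝ) × (Fin r → ℝ) =>
      ENNReal.ofReal (∏ k : Fin r, q.2 k ^ (r - 1 - (k : ℕ))) *
        f (pieceMap S (σ.trans ε) q) := fun σ =>
    (measurable_prod_pow_snd r).mul (hf.comp (measurable_pieceMap S _))
  have e : ∀ σ : Equiv.Perm (Fin r), ∫⁻ q, ENNReal.ofReal (∏ k : Fin r, q.2 k ^ (r - 1 - (k : ℕ))) *
        f (pieceMap S (σ.trans ε) q) ∂(pieceMeasure S r) =
      ∫⁻ p, ∫⁻ u, ENNReal.ofReal (∏ k : Fin r, u k ^ (r - 1 - (k : ℕ))) *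
        f (pieceMap S (σ.trans ε) (p, u)) ∂(Measure.pi fun _ => unitMeasure)
          ∂(Measure.pi fun _ => tailMeasure) := fun σ => lintegral_prod _ (hJ σ).aemeasurable
  simp only [e]
  rw [← lintegral_finsetSum _ fun σ _ => (hJ σ).lintegral_prod_right']
  refine lintegral_congr fun p => ?_
  exact lintegral_unit_sort (hgf.comp measurable_prodMk_left)

theorem exists_pieces (n : ℕ) : ∃ (ι : Type) (_ : Fintype ι) (S : ι → Finset (Fin n)) (r : ι → ℕ)
    (e : ∀ i, Fin (r i) ≃ {j // j ∉ S i}), ∀ f : (Fin n → ℂ) → ℂ,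
      Integrable (fun x : Fin n → ℝ => f fun j => x j) (Measure.pi fun _ => halfMeasure) →
      (∀ i, Integrable (fun q => (∏ k : Fin (r i), (q.2 k : ℂ) ^ (r i - 1 - (k : ℕ))) *
        f fun j => pieceMap (S i) (e i) q j) (pieceMeasure (S i) (r i))) ∧
      ∫ x : Fin n → ℝ, (f fun j => x j) ∂(Measure.pi fun _ => halfMeasure) =
        ∑ i, ∫ q, (∏ k : Fin (r i), (q.2 k : ℂ) ^ (r i - 1 - (k : ℕ))) *
          f (fun j => pieceMap (S i) (e i) q j) ∂(pieceMeasure (S i) (r i)) := by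
  let ε : ∀ S : Finset (Fin n), Fin (Fintype.card {j // j ∉ S}) ≃ {j // j ∉ S} :=
    fun S => (Fintype.equivFin _).symm
  refine ⟨Σ S : Finset (Fin n), Equiv.Perm (Fin (Fintype.card {j // j ∉ S})), inferInstance,
    Sigma.fst, fun i => Fintype.card {j // j ∉ i.1}, fun i => i.2.trans (ε i.1), ?_⟩
  set ι := Σ S : Finset (Fin n), Equiv.Perm (Fin (Fintype.card {j // j ∉ S}))
  set r : ι → ℕ := fun i => Fintype.card {j // j ∉ i.1} with hr
  set e : ∀ i : ι, Fin (r i) ≃ {j // j ∉ i.1} := fun i => i.2.trans (ε i.1) with he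
  set J : ∀ i : ι, ({j // j ∈ i.1} → ℝ) × (Fin (r i) → ℝ) → ENNReal := fun i q =>
    ENNReal.ofReal (∏ k : Fin (r i), q.2 k ^ (r i - 1 - (k : ℕ))) with hJ
  have hJm : ∀ i, Measurable (J i) := fun i => measurable_prod_pow_snd _
  have hμ : (Measure.pi fun _ : Fin n => halfMeasure) = ∑ i : ι,
      ((pieceMeasure i.1 (r i)).withDensity (J i)).map (pieceMap i.1 (e i)) := by
    refine Measure.ext_of_lintegral _ fun f hf => ?_
    rw [pi_halfMeasure_eq_sum, lintegral_finsetSum_measure, lintegral_finsetSum_measure,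
      Fintype.sum_sigma]
    refine Finset.sum_congr rfl fun S _ => ?_
    rw [lintegral_pi_ite S (ε S) hf]
    refine Finset.sum_congr rfl fun σ _ => ?_
    rw [lintegral_map hf (measurable_pieceMap _ _)]
    exact (lintegral_withDensity_eq_lintegral_mul _ (hJm ⟨S, σ⟩)
      (hf.comp (measurable_pieceMap _ _))).symm
  intro f hf
  rw [hμ] at hf ⊢
  have hfi := integrable_finsetSum_measure.1 hf
  have hJtop : ∀ i, ∀ᵐ q ∂(pieceMeasure i.1 (r i)), J i q < ⊤ :=
    fun i => Filter.Eventually.of_forall fun q => ENNReal.ofReal_lt_top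
  have hJr : ∀ i, ∀ᵐ q ∂(pieceMeasure i.1 (r i)),
      (J i q).toReal • (f fun j => pieceMap i.1 (e i) q j) =
        (∏ k : Fin (r i), (q.2 k : ℂ) ^ (r i - 1 - (k : ℕ))) *
          f (fun j => pieceMap i.1 (e i) q j) := by
    intro i
    filter_upwards [Measure.quasiMeasurePreserving_snd.ae (ae_pi_unitMeasure_mem (r i))] with q hq
    rw [hJ, ENNReal.toReal_ofReal (Finset.prod_nonneg fun k _ => pow_nonneg (hq k).1.le _),
      Complex.real_smul]
    push_cast
    rfl
  have hmap : ∀ i : ι, Integrable (fun q => f fun j => pieceMap i.1 (e i) q j)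
      ((pieceMeasure i.1 (r i)).withDensity (J i)) := fun i =>
    (integrable_map_measure (hfi i (Finset.mem_univ i)).1
      (measurable_pieceMap _ _).aemeasurable).1 (hfi i (Finset.mem_univ i))
  refine ⟨fun i => ?_, ?_⟩
  · have := (integrable_withDensity_iff_integrable_smul' (hJm i) (hJtop i)).1 (hmap i)
    exact this.congr (hJr i)
  · rw [integral_finsetSum_measure hfi]
    refine Finset.sum_congr rfl fun i _ => ?_
    rw [integral_map (measurable_pieceMap _ _).aemeasurable (hfi i (Finset.mem_univ i)).1,
      integral_withDensity_eq_integral_toReal_smul (hJm i) (hJtop i)]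
    exact integral_congr_ae (hJr i)

/-- The products `u (κ + 1) * ⋯ * u k`, the ratios of the cumulative products. -/
def tailProd {R : Type*} [CommMonoid R] {r : ℕ} (κ k : Fin r) (u : Fin r → R) : R :=
  ∏ i, if κ < i ∧ i ≤ k then u i else 1

theorem cumProd_mul_tailProd {R : Type*} [CommMonoid R] {r : ℕ} {κ k : Fin r} (h : κ ≤ k)
    (u : Fin r → R) : cumProd u κ * tailProd κ k u = cumProd u k := by
  rw [cumProd, tailProd, cumProd, ← Finset.prod_mul_distrib]
  refine Finset.prod_congr rfl fun i _ => ?_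
  rcases le_or_gt i κ with hi | hi
  · rw [if_pos hi, if_neg fun h' => absurd hi (not_le.2 h'.1), if_pos (hi.trans h), mul_one]
  · rw [if_neg (not_le.2 hi), one_mul]
    simp [hi]

/-- The linear forms on a piece: `p` and `x` are the coefficients of the forms involving
a coordinate in `(1, ∞)`, and `c` those of the other forms, `κ` being the first index with
a nonzero coefficient. -/
structure Piece (A R Q : Type) (r : ℕ) where
  p : R → A → ℂ
  x : R → Fin r → ℂ
  c : Q → Fin r → ℂ
  κ : Q → Fin r

namespace Piece

variable {A R Q : Type} {r : ℕ}

/-- The quotient of the form `∑ k, c q k * x k` by its largest variable. -/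
def quot (D : Piece A R Q r) (q : Q) (u : Fin r → ℂ) : ℂ :=
  ∑ k, D.c q k * tailProd (D.κ q) k u

/-- The form `∑ k, c q k * x k` in the coordinates `u`. -/
def form (D : Piece A R Q r) (q : Q) (u : Fin r → ℂ) : ℂ :=
  cumProd u (D.κ q) * D.quot q u

/-- The positivity and smallness assumptions on a piece. -/
structure Valid (D : Piece A R Q r) (c₀ : ℝ) : Prop where
  pos : 0 < c₀
  p_re : ∀ i α, 0 ≤ (D.p i α).re
  p_big : ∀ i, ∃ α, c₀ ≤ (D.p i α).re
  x_re : ∀ i k, 0 ≤ (D.x i k).re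
  c_re : ∀ q k, 0 ≤ (D.c q k).re
  c_big : ∀ q, c₀ ≤ (D.c q (D.κ q)).re
  c_zero : ∀ q k, k < D.κ q → D.c q k = 0
  small : ∀ q, ∑ k, ‖D.c q k‖ < 1

theorem Valid.form_eq {D : Piece A R Q r} {c₀ : ℝ} (h : D.Valid c₀) (q : Q) (u : Fin r → ℂ) :
    D.form q u = ∑ k, D.c q k * cumProd u k := by
  rw [form, quot, Finset.mul_sum]
  refine Finset.sum_congr rfl fun k _ => ?_
  rcases lt_or_ge k (D.κ q) with hk | hk
  · simp [h.c_zero q k hk]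
  · rw [← cumProd_mul_tailProd hk u]
    ring

/-- The region of the parameters `u` on which the estimates hold. -/
structure Good (D : Piece A R Q r) (c₀ : ℝ) (u : Fin r → ℂ) : Prop where
  x_re : ∀ i, -(c₀ / 2) < (∑ k, D.x i k * cumProd u k).re
  quot_re : ∀ q, c₀ / 2 < (D.quot q u).re
  form_norm : ∀ q, ‖D.form q u‖ < 1
  cumProd_norm : ∀ k, ‖cumProd u k‖ < 2

theorem continuous_cumProd (k : Fin r) : Continuous fun u : Fin r → ℂ => cumProd u k := by
  unfold cumProd
  refine continuous_finsetProd _ fun i _ => ?_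
  split_ifs <;> fun_prop

theorem continuous_tailProd (κ k : Fin r) : Continuous fun u : Fin r → ℂ => tailProd κ k u := by
  unfold tailProd
  refine continuous_finsetProd _ fun i _ => ?_
  split_ifs <;> fun_prop

theorem continuous_quot (D : Piece A R Q r) (q : Q) : Continuous (D.quot q) :=
  continuous_finsetSum _ fun k _ => continuous_const.mul (continuous_tailProd _ k)

theorem continuous_form (D : Piece A R Q r) (q : Q) : Continuous (D.form q) :=
  (continuous_cumProd _).mul (D.continuous_quot q)

theorem continuous_x (D : Piece A R Q r) (i : R) :
    Continuous fun u : Fin r → ℂ => ∑ k, D.x i k * cumProd u k :=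
  continuous_finsetSum _ fun k _ => continuous_const.mul (continuous_cumProd k)

theorem isOpen_good [Finite R] [Finite Q] (D : Piece A R Q r) (c₀ : ℝ) :
    IsOpen {u | D.Good c₀ u} := by
  have e : {u | D.Good c₀ u} =
      ((⋂ i, {u | -(c₀ / 2) < (∑ k, D.x i k * cumProd u k).re}) ∩
        ⋂ q, {u | c₀ / 2 < (D.quot q u).re}) ∩
      ((⋂ q, {u | ‖D.form q u‖ < 1}) ∩ ⋂ k, {u | ‖cumProd u k‖ < 2}) := by
    ext u
    simp only [Set.mem_ofPred_eq, Set.mem_inter_iff, Set.mem_iInter]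
    exact ⟨fun h => ⟨⟨h.1, h.2⟩, h.3, h.4⟩, fun h => ⟨h.1.1, h.1.2, h.2.1, h.2.2⟩⟩
  rw [e]
  refine ((isOpen_iInter_of_finite fun i => ?_).inter (isOpen_iInter_of_finite fun q => ?_)).inter
    ((isOpen_iInter_of_finite fun q => ?_).inter (isOpen_iInter_of_finite fun k => ?_))
  · exact isOpen_lt continuous_const (continuous_re.comp (D.continuous_x i))
  · exact isOpen_lt continuous_const (continuous_re.comp (D.continuous_quot q))
  · exact isOpen_lt (D.continuous_form q).norm continuous_const
  · exact isOpen_lt (continuous_cumProd k).norm continuous_const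

theorem prod_ite_mem_Icc {v : Fin r → ℝ} (hv : ∀ k, v k ∈ Set.Icc (0 : ℝ) 1)
    (p : Fin r → Prop) [DecidablePred p] :
    ∃ y ∈ Set.Icc (0 : ℝ) 1, (∏ i, if p i then (v i : ℂ) else 1) = (y : ℂ) := by
  refine ⟨∏ i, if p i then v i else 1, ⟨Finset.prod_nonneg fun i _ => ?_,
    Finset.prod_le_one (fun i _ => ?_) fun i _ => ?_⟩, ?_⟩
  · split_ifs
    exacts [(hv i).1, zero_le_one]
  · split_ifs
    exacts [(hv i).1, zero_le_one]
  · split_ifs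
    exacts [(hv i).2, le_rfl]
  · push_cast
    exact Finset.prod_congr rfl fun i _ => by split_ifs <;> simp

theorem re_mul_nonneg {z : ℂ} (hz : 0 ≤ z.re) {y : ℝ} (hy : 0 ≤ y) : 0 ≤ (z * y).re := by
  simpa using mul_nonneg hz hy

theorem Valid.good_ofReal {D : Piece A R Q r} {c₀ : ℝ} (h : D.Valid c₀) {v : Fin r → ℝ}
    (hv : ∀ k, v k ∈ Set.Icc (0 : ℝ) 1) : D.Good c₀ fun k => (v k : ℂ) := by
  have hcum : ∀ k, ∃ y ∈ Set.Icc (0 : ℝ) 1, cumProd (fun k => (v k : ℂ)) k = (y : ℂ) :=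
    fun k => prod_ite_mem_Icc hv _
  have htail : ∀ κ k, ∃ y ∈ Set.Icc (0 : ℝ) 1, tailProd κ k (fun k => (v k : ℂ)) = (y : ℂ) :=
    fun κ k => prod_ite_mem_Icc hv _
  have hnorm : ∀ k, ‖cumProd (fun k => (v k : ℂ)) k‖ ≤ 1 := fun k => by
    obtain ⟨y, hy, e⟩ := hcum k
    rw [e, norm_real, Real.norm_of_nonneg hy.1]
    exact hy.2
  have hc := h.pos
  refine ⟨fun i => ?_, fun q => ?_, fun q => ?_, fun k => (hnorm k).trans_lt one_lt_two⟩
  · refine lt_of_lt_of_le (b := 0) (by linarith) ?_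
    rw [re_sum]
    refine Finset.sum_nonneg fun k _ => ?_
    obtain ⟨y, hy, e⟩ := hcum k
    rw [e]
    exact re_mul_nonneg (h.x_re i k) hy.1
  · have h1 : (D.c q (D.κ q)).re ≤ (D.quot q fun k => (v k : ℂ)).re := by
      rw [quot, re_sum]
      have h2 : D.c q (D.κ q) = D.c q (D.κ q) * tailProd (D.κ q) (D.κ q) fun k => (v k : ℂ) := by
        have : (tailProd (D.κ q) (D.κ q) fun k => (v k : ℂ)) = 1 := by
          refine Finset.prod_eq_one fun i _ => if_neg fun h' => ?_
          exact absurd h'.1 (not_lt.2 h'.2)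
        rw [this, mul_one]
      rw [h2]
      refine Finset.single_le_sum
        (f := fun k => (D.c q k * tailProd (D.κ q) k fun k => (v k : ℂ)).re) (fun k _ => ?_)
        (Finset.mem_univ (D.κ q))
      obtain ⟨y, hy, e⟩ := htail (D.κ q) k
      rw [e]
      exact re_mul_nonneg (h.c_re q k) hy.1
    have := h.c_big q
    linarith
  · rw [h.form_eq]
    refine (norm_sum_le _ _).trans_lt (lt_of_le_of_lt (Finset.sum_le_sum fun k _ => ?_) (h.small q))
    rw [norm_mul]
    exact mul_le_of_le_one_right (norm_nonneg _) (hnorm k)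

theorem Valid.exists_nhd [Finite R] [Finite Q] {D : Piece A R Q r} {c₀ : ℝ} (h : D.Valid c₀) :
    ∃ V ρ, IsUnitNhd V ρ ∧ ∀ u, (∀ k, u k ∈ V) → D.Good c₀ u := by
  have hK : IsCompact ((fun v : Fin r → ℝ => fun k => (v k : ℂ)) ''
      Set.univ.pi fun _ => Set.Icc (0 : ℝ) 1) :=
    (isCompact_univ_pi fun _ => isCompact_Icc).image (by fun_prop)
  obtain ⟨δ, hδ, hsub⟩ := hK.exists_thickening_subset_open (D.isOpen_good c₀) (by
    rintro _ ⟨v, hv, rfl⟩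
    exact h.good_ofReal fun k => hv k trivial)
  refine ⟨Metric.thickening δ ((fun t : ℝ => (t : ℂ)) '' Set.Icc 0 1), δ / 2,
    ⟨Metric.isOpen_thickening, half_pos hδ, fun t ht z hz => ?_⟩, fun u hu => hsub ?_⟩
  · exact Metric.mem_thickening_iff.2 ⟨_, ⟨t, ht, rfl⟩,
      (Metric.mem_closedBall.1 hz).trans_lt (half_lt_self hδ)⟩
  · have : ∀ k, ∃ v ∈ Set.Icc (0 : ℝ) 1, dist (u k) (v : ℂ) < δ := fun k => by
      obtain ⟨_, ⟨v, hv, rfl⟩, hd⟩ := Metric.mem_thickening_iff.1 (hu k)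
      exact ⟨v, hv, hd⟩
    choose v hv hd using this
    exact Metric.mem_thickening_iff.2 ⟨_, ⟨v, fun k _ => hv k, rfl⟩, (dist_pi_lt_iff hδ).2 hd⟩

end Piece

theorem aestronglyMeasurable_comp_of_ae_mem {X : Type*} [MeasurableSpace X] {μ : Measure X}
    {Λ : ℂ → ℂ} {S : Set ℂ} (hΛ : ContinuousOn Λ S) (hS : IsOpen S) {φ : X → ℂ}
    (hφ : Measurable φ) (hmem : ∀ᵐ x ∂μ, φ x ∈ S) :
    AEStronglyMeasurable (fun x => Λ (φ x)) μ := by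
  have hm : Measurable (S.piecewise Λ fun _ => 0) :=
    hΛ.measurable_piecewise continuousOn_const hS.measurableSet
  refine (hm.comp hφ).aestronglyMeasurable.congr ?_
  filter_upwards [hmem] with x hx
  simp [Set.piecewise_eq_of_mem _ _ _ hx]

theorem ae_pi_tailMeasure_mem {A : Type} [Fintype A] :
    ∀ᵐ p ∂(Measure.pi fun _ : A => tailMeasure), ∀ α, 1 < p α := by
  refine ae_all_iff.2 fun α => ?_
  exact (Measure.tendsto_eval_ae_ae (μ := fun _ : A => tailMeasure)).eventually
    (ae_restrict_mem measurableSet_Ioi)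

namespace Piece

variable {A R Q : Type} {r : ℕ} [Fintype A] [Fintype R] [Fintype Q]
  {T : Type*} [MeasurableSpace T] {ν : Measure T} {τ : T → ℝ} {Λ b : ℂ → ℂ}
  {D : Piece A R Q r} {c₀ : ℝ} {wA : A → ℂ} {wR : Fin r → ℂ}

/-- The Mellin integrand on a piece, after division by its monomial part in `u`. -/
def integrand (D : Piece A R Q r) (Λ b : ℂ → ℂ) (wA : A → ℂ) (wR : Fin r → ℂ) (s : ℂ) (p : A → ℝ)
    (u : Fin r → ℂ) : ℂ :=
  (∏ α, (p α : ℂ) ^ (s - 1)) * cexp (-(∑ α, wA α * p α) - ∑ k, wR k * cumProd u k) *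
    (∏ i, Λ (∑ α, D.p i α * p α + ∑ k, D.x i k * cumProd u k)) *
    ∏ q, b (D.form q u) * (D.quot q u)⁻¹

theorem Valid.re_arg {A R Q : Type} {r : ℕ} [Fintype A] {D : Piece A R Q r} {c₀ : ℝ}
    (hv : D.Valid c₀) {p : A → ℝ} (hp : ∀ α, 1 < p α) {u : Fin r → ℂ} (hu : D.Good c₀ u) (i : R) :
    c₀ / 2 ≤ (∑ α, D.p i α * p α + ∑ k, D.x i k * cumProd u k).re := by
  obtain ⟨α, hα⟩ := hv.p_big i
  have h1 : (D.p i α * p α).re ≤ (∑ α, D.p i α * p α).re := by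
    rw [re_sum]
    exact Finset.single_le_sum (f := fun α => (D.p i α * p α).re)
      (fun α _ => re_mul_nonneg (hv.p_re i α) (zero_le_one.trans (hp α).le)) (Finset.mem_univ α)
  have h2 : (D.p i α).re ≤ (D.p i α * p α).re := by
    rw [re_mul_ofReal]
    exact le_mul_of_one_le_right (hv.p_re i α) (hp α).le
  have h3 := hu.x_re i
  rw [add_re]
  linarith

theorem Good.quot_ne_zero {A R Q : Type} {r : ℕ} {D : Piece A R Q r} {c₀ : ℝ}
    (hv : D.Valid c₀) {u : Fin r → ℂ} (hu : D.Good c₀ u) (q : Q) :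
    D.quot q u ≠ 0 := by
  intro h
  have h1 := hu.quot_re q
  have h2 := hv.pos
  rw [h, zero_re] at h1
  linarith

theorem exists_integrand_bound (h : LaplaceKernel ν τ Λ b) (hv : D.Valid c₀)
    (hw : ∀ α, 0 < (wA α).re) {M : ℝ} (hM : 0 < M) :
    ∃ B : (A → ℝ) → ℝ, Integrable B (Measure.pi fun _ => tailMeasure) ∧
      ∀ s : ℂ, s.re ≤ M → ∀ p : A → ℝ, (∀ α, 1 < p α) → ∀ u, D.Good c₀ u →
        ‖D.integrand Λ b wA wR s p u‖ ≤ B p := by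
  obtain ⟨CΛ, hCΛ⟩ := h.bound (c₀ / 2) (half_pos hv.pos)
  obtain ⟨Cb, hCb⟩ := (isCompact_closedBall (0 : ℂ) 1).exists_bound_of_continuousOn
    (h.hol_b.continuousOn.mono (Metric.closedBall_subset_ball (by norm_num)))
  refine ⟨fun p => (∏ α, p α ^ (M - 1) * Real.exp (-((wA α).re * p α))) *
    (Real.exp (∑ k, ‖wR k‖ * 2) * (∏ _i : R, CΛ) * ∏ _q : Q, Cb * (c₀ / 2)⁻¹),
    (Integrable.fintype_prod (f := fun α (x : ℝ) => x ^ (M - 1) * Real.exp (-((wA α).re * x)))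
      fun α => (integrable_rpow_mul_exp hM (hw α)).mono_measure
        (Measure.restrict_mono (Set.Ioi_subset_Ioi zero_le_one) le_rfl)).mul_const _, ?_⟩
  intro s hs p hp u hu
  have e1 : ‖(∏ α, (p α : ℂ) ^ (s - 1)) * cexp (-(∑ α, wA α * p α) - ∑ k, wR k * cumProd u k)‖ ≤
      (∏ α, p α ^ (M - 1) * Real.exp (-((wA α).re * p α))) * Real.exp (∑ k, ‖wR k‖ * 2) := by
    rw [norm_mul, norm_prod, norm_exp, sub_re, Real.exp_sub, Finset.prod_mul_distrib,
      div_eq_mul_inv, ← Real.exp_neg, mul_assoc]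
    refine mul_le_mul (Finset.prod_le_prod (fun _ _ => norm_nonneg _) fun α _ => ?_)
      (mul_le_mul (le_of_eq ?_) (Real.exp_le_exp.2 ?_) (Real.exp_pos _).le ?_) ?_ ?_
    · have hpos : 0 < p α := zero_lt_one.trans (hp α)
      rw [norm_cpow_eq_rpow_re_of_pos hpos]
      exact Real.rpow_le_rpow_of_exponent_le (hp α).le (by simpa using hs)
    · rw [neg_re, re_sum, ← Real.exp_sum, ← Finset.sum_neg_distrib]
      simp only [re_mul_ofReal]
    · refine (neg_le_abs _).trans ((abs_re_le_norm _).trans ((norm_sum_le _ _).trans ?_))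
      refine Finset.sum_le_sum fun k _ => ?_
      rw [norm_mul]
      exact mul_le_mul_of_nonneg_left (hu.cumProd_norm k).le (norm_nonneg _)
    · exact Finset.prod_nonneg fun _ _ => (Real.exp_pos _).le
    · positivity
    · exact Finset.prod_nonneg fun α _ => Real.rpow_nonneg (zero_le_one.trans (hp α).le) _
  have e2 : ‖∏ i, Λ (∑ α, D.p i α * p α + ∑ k, D.x i k * cumProd u k)‖ ≤ ∏ _i : R, CΛ := by
    rw [norm_prod]
    exact Finset.prod_le_prod (fun _ _ => norm_nonneg _) fun i _ => hCΛ _ (hv.re_arg hp hu i)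
  have e3 : ‖∏ q, b (D.form q u) * (D.quot q u)⁻¹‖ ≤ ∏ _q : Q, Cb * (c₀ / 2)⁻¹ := by
    rw [norm_prod]
    refine Finset.prod_le_prod (fun _ _ => norm_nonneg _) fun q _ => ?_
    have hb := hCb (D.form q u) (by simpa using (hu.form_norm q).le)
    rw [norm_mul, norm_inv]
    refine mul_le_mul hb (inv_anti₀ (half_pos hv.pos) ?_) (inv_nonneg.2 (norm_nonneg _))
      ((norm_nonneg _).trans hb)
    exact (hu.quot_re q).le.trans (re_le_norm _)
  rw [integrand, norm_mul, norm_mul]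
  refine (mul_le_mul (mul_le_mul e1 e2 (norm_nonneg _) ((norm_nonneg _).trans e1)) e3
    (norm_nonneg _) (mul_nonneg ((norm_nonneg _).trans e1) ((norm_nonneg _).trans e2))).trans ?_
  exact le_of_eq (by ring)

theorem isOpen_re_pos : IsOpen {z : ℂ | 0 < z.re} := isOpen_lt continuous_const continuous_re

theorem aestronglyMeasurable_integrand (h : LaplaceKernel ν τ Λ b) (hv : D.Valid c₀)
    {X : Type*} [MeasurableSpace X] {μ : Measure X} {P : X → A → ℝ} {U : X → Fin r → ℂ}
    (hP : Measurable P) (hU : Measurable U) (hPm : ∀ᵐ x ∂μ, ∀ α, 1 < P x α)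
    (hUm : ∀ᵐ x ∂μ, D.Good c₀ (U x)) (s : ℂ) :
    AEStronglyMeasurable (fun x => D.integrand Λ b wA wR s (P x) (U x)) μ := by
  have hc : ∀ k, Measurable fun x => cumProd (U x) k := fun k =>
    (continuous_cumProd k).measurable.comp hU
  refine AEStronglyMeasurable.mul (AEStronglyMeasurable.mul (AEStronglyMeasurable.mul ?_ ?_) ?_) ?_
  · exact Measurable.aestronglyMeasurable (by fun_prop)
  · exact Measurable.aestronglyMeasurable (by fun_prop)
  · refine Finset.aestronglyMeasurable_fun_prod _ fun i _ =>
      aestronglyMeasurable_comp_of_ae_mem h.hol.continuousOn isOpen_re_pos (by fun_prop) ?_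
    filter_upwards [hPm, hUm] with x h1 h2
    exact (half_pos hv.pos).trans_le (hv.re_arg h1 h2 i)
  · refine Finset.aestronglyMeasurable_fun_prod _ fun q _ => AEStronglyMeasurable.mul ?_ ?_
    · refine aestronglyMeasurable_comp_of_ae_mem h.hol_b.continuousOn Metric.isOpen_ball
        ((D.continuous_form q).measurable.comp hU) ?_
      filter_upwards [hUm] with x hx
      simpa using (hx.form_norm q).trans one_lt_two
    · exact ((D.continuous_quot q).measurable.comp hU).inv.aestronglyMeasurable

theorem differentiableOn_prod_of_normedSpace {E ι : Type*} [NormedAddCommGroup E] [NormedSpace ℂ E]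
    {S : Set E} {f : ι → E → ℂ} (t : Finset ι) (h : ∀ i, DifferentiableOn ℂ (f i) S) :
    DifferentiableOn ℂ (fun x => ∏ i ∈ t, f i x) S := by
  induction t using Finset.induction_on with
  | empty => simp
  | insert i t hi ih =>
    simp only [Finset.prod_insert hi]
    exact (h i).fun_mul ih

theorem differentiable_prod_ite (p : Fin r → Prop) [DecidablePred p] :
    Differentiable ℂ fun u : Fin r → ℂ => ∏ i, if p i then u i else 1 := by
  refine differentiableOn_univ.1 (differentiableOn_prod_of_normedSpace _ fun i => ?_)
  split_ifs <;> fun_prop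

theorem differentiable_cumProd (k : Fin r) : Differentiable ℂ fun u : Fin r → ℂ => cumProd u k :=
  differentiable_prod_ite _

theorem differentiable_quot {A R Q : Type} {r : ℕ} (D : Piece A R Q r) (q : Q) :
    Differentiable ℂ (D.quot q) :=
  Differentiable.fun_sum fun _ _ => (differentiable_const _).mul (differentiable_prod_ite _)

theorem differentiable_form {A R Q : Type} {r : ℕ} (D : Piece A R Q r) (q : Q) :
    Differentiable ℂ (D.form q) :=
  (differentiable_cumProd _).mul (D.differentiable_quot q)

theorem differentiableOn_integrand (h : LaplaceKernel ν τ Λ b) (hv : D.Valid c₀) (s : ℂ)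
    {p : A → ℝ} (hp : ∀ α, 1 < p α) :
    DifferentiableOn ℂ (D.integrand Λ b wA wR s p) {u | D.Good c₀ u} := by
  have hc := fun k => (differentiable_cumProd (r := r) k).differentiableOn (s := {u | D.Good c₀ u})
  refine DifferentiableOn.mul (DifferentiableOn.mul (DifferentiableOn.mul
    (differentiableOn_const _) ?_) ?_) ?_
  · exact ((differentiableOn_const _).sub (DifferentiableOn.fun_sum fun k _ =>
      (differentiableOn_const _).mul (hc k))).cexp
  · refine differentiableOn_prod_of_normedSpace _ fun i => ?_
    refine h.hol.comp ((differentiableOn_const _).add (DifferentiableOn.fun_sum fun k _ =>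
      (differentiableOn_const _).mul (hc k))) fun u hu => ?_
    exact (half_pos hv.pos).trans_le (hv.re_arg hp hu i)
  · refine differentiableOn_prod_of_normedSpace _ fun q => DifferentiableOn.fun_mul ?_ ?_
    · refine h.hol_b.comp (D.differentiable_form q).differentiableOn fun u hu => ?_
      simpa using (Good.form_norm hu q).trans one_lt_two
    · exact (D.differentiable_quot q).differentiableOn.inv fun u hu => Good.quot_ne_zero hv hu q

/-- The integrand on a piece, integrated over the coordinates in `(1, ∞)`. -/
def fiber (D : Piece A R Q r) (Λ b : ℂ → ℂ) (wA : A → ℂ) (wR : Fin r → ℂ) (s : ℂ)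
    (u : Fin r → ℂ) : ℂ :=
  ∫ p, D.integrand Λ b wA wR s p u ∂(Measure.pi fun _ => tailMeasure)

theorem exists_holB_fiber (h : LaplaceKernel ν τ Λ b) (hv : D.Valid c₀)
    (hw : ∀ α, 0 < (wA α).re) {M : ℝ} (hM : 0 < M) {V W : Set ℂ} (hV : IsOpen V)
    (hVg : ∀ u, (∀ k, u k ∈ V) → D.Good c₀ u) (hW : IsOpen W) (hWM : ∀ s ∈ W, s.re ≤ M) :
    ∃ B, HolB W V B (D.fiber Λ b wA wR) := by
  obtain ⟨B, hB, hb⟩ := exists_integrand_bound (wR := wR) h hv hw hM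
  have hae : ∀ᵐ p ∂(Measure.pi fun _ : A => tailMeasure), ∀ α, 1 < p α := ae_pi_tailMeasure_mem
  have hm : ∀ s u, D.Good c₀ u → AEStronglyMeasurable (fun p => D.integrand Λ b wA wR s p u)
      (Measure.pi fun _ => tailMeasure) := fun s u hu =>
    aestronglyMeasurable_integrand h hv measurable_id measurable_const hae
      (Filter.Eventually.of_forall fun _ => hu) s
  have hupd : ∀ u : Fin r → ℂ, (∀ k, u k ∈ V) → ∀ k, ∀ t ∈ V,
      D.Good c₀ (Function.update u k t) := fun u hu k t ht => hVg _ fun j => by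
    rcases eq_or_ne j k with rfl | hj
    · simpa using ht
    · simpa [hj] using hu j
  refine ⟨∫ p, B p ∂(Measure.pi fun _ => tailMeasure), ⟨fun s hs => ⟨fun u hu => ?_,
    fun u hu k => ?_⟩, fun u hu => ?_⟩⟩
  · refine norm_integral_le_of_norm_le hB ?_
    filter_upwards [hae] with p hp
    exact hb s (hWM s hs) p hp u (hVg u hu)
  · refine differentiableOn_integral_of_bound hV hB
      (f := fun t p => D.integrand Λ b wA wR s p (Function.update u k t))
      (fun t ht => hm s _ (hupd u hu k t ht)) ?_ ?_
    · filter_upwards [hae] with p hp t ht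
      exact hb s (hWM s hs) p hp _ (hupd u hu k t ht)
    · filter_upwards [hae] with p hp
      refine (differentiableOn_integrand h hv s hp).comp (fun t _ => ?_)
        fun t ht => hupd u hu k t ht
      exact (hasFDerivAt_update u t).differentiableAt.differentiableWithinAt
  · refine differentiableOn_integral_of_bound hW hB
      (f := fun s p => D.integrand Λ b wA wR s p u) (fun s _ => hm s u (hVg u hu)) ?_ ?_
    · filter_upwards [hae] with p hp s hs
      exact hb s (hWM s hs) p hp u (hVg u hu)
    · filter_upwards [hae] with p hp
      refine Differentiable.differentiableOn ?_
      unfold integrand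
      refine Differentiable.mul_const (Differentiable.mul_const (Differentiable.mul_const ?_ _) _) _
      refine Differentiable.fun_finsetProd fun α _ => ?_
      refine Differentiable.const_cpow (by fun_prop) (Or.inl ?_)
      exact ofReal_ne_zero.2 (zero_lt_one.trans (hp α)).ne'

end Piece

theorem prod_eq_prod_mul_prod_equiv {M : Type*} [CommMonoid M] {n r : ℕ} {S : Finset (Fin n)}
    (e : Fin r ≃ {j // j ∉ S}) (g : Fin n → M) :
    ∏ j, g j = (∏ α : {j // j ∈ S}, g α) * ∏ k, g (e k) := by
  rw [e.prod_comp fun j => g j]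
  convert (Fintype.prod_subtype_mul_prod_subtype (· ∈ S) g).symm

theorem sum_eq_sum_add_sum_equiv {M : Type*} [AddCommMonoid M] {n r : ℕ} {S : Finset (Fin n)}
    (e : Fin r ≃ {j // j ∉ S}) (g : Fin n → M) :
    ∑ j, g j = ∑ α : {j // j ∈ S}, g α + ∑ k, g (e k) := by
  rw [e.sum_comp fun j => g j]
  convert (Fintype.sum_subtype_add_sum_subtype (· ∈ S) g).symm

theorem ofReal_cumProd {r : ℕ} (v : Fin r → ℝ) (k : Fin r) :
    ((cumProd v k : ℝ) : ℂ) = cumProd (fun k => (v k : ℂ)) k := by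
  simp only [cumProd, ofReal_prod]
  exact Finset.prod_congr rfl fun i _ => by split_ifs <;> simp

theorem cumProd_mem_Ioc {r : ℕ} {v : Fin r → ℝ} (hv : ∀ k, v k ∈ Set.Ioc (0 : ℝ) 1) (k : Fin r) :
    cumProd v k ∈ Set.Ioc (0 : ℝ) 1 := by
  refine ⟨Finset.prod_pos fun i _ => ?_, Finset.prod_le_one (fun i _ => ?_) fun i _ => ?_⟩ <;>
    split_ifs
  exacts [(hv i).1, one_pos, (hv i).1.le, zero_le_one, (hv i).2, le_rfl]

theorem ofReal_prod_cpow {ι : Type*} (t : Finset ι) {f : ι → ℝ} (hf : ∀ i, 0 ≤ f i) (z : ℂ) :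
    ((∏ i ∈ t, f i : ℝ) : ℂ) ^ z = ∏ i ∈ t, (f i : ℂ) ^ z := by
  induction t using Finset.induction_on with
  | empty => simp
  | insert i t hi ih =>
    rw [Finset.prod_insert hi, Finset.prod_insert hi, ofReal_mul,
      mul_cpow_ofReal_nonneg (hf i) (Finset.prod_nonneg fun j _ => hf j), ih]

theorem card_filter_le_fin {r : ℕ} (i : Fin r) :
    (Finset.univ.filter fun k : Fin r => i ≤ k).card = r - i := by
  have : (Finset.univ.filter fun k : Fin r => i ≤ k) = Finset.Ici i := by
    ext; simp
  rw [this, Fin.card_Ici]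

theorem prod_cumProd_cpow {r : ℕ} {v : Fin r → ℝ} (hv : ∀ k, 0 < v k) (z : ℂ) :
    ∏ k, ((cumProd v k : ℝ) : ℂ) ^ z = ∏ i, ((v i : ℂ) ^ z) ^ (r - (i : ℕ)) := by
  have h : ∀ k, ((cumProd v k : ℝ) : ℂ) ^ z = ∏ i, if i ≤ k then (v i : ℂ) ^ z else 1 := by
    intro k
    rw [cumProd, ofReal_prod_cpow]
    · exact Finset.prod_congr rfl fun i _ => by split_ifs <;> simp
    · intro i
      split_ifs
      exacts [(hv i).le, zero_le_one]
  simp only [h]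
  rw [Finset.prod_comm]
  refine Finset.prod_congr rfl fun i _ => ?_
  rw [← Finset.prod_filter, Finset.prod_const, card_filter_le_fin]

theorem prod_cumProd_comp {Q : Type*} [Fintype Q] {R : Type*} [CommMonoid R] {r : ℕ}
    (κ : Q → Fin r) (v : Fin r → R) :
    ∏ q, cumProd v (κ q) = ∏ i, v i ^ (Finset.univ.filter fun q => i ≤ κ q).card := by
  simp only [cumProd]
  rw [Finset.prod_comm]
  refine Finset.prod_congr rfl fun i _ => ?_
  rw [← Finset.prod_filter, Finset.prod_const]

theorem cpow_monomial {v : ℂ} (hv : v ≠ 0) {r k m : ℕ} (hk : k < r) (s : ℂ) :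
    v ^ (r - 1 - k) * (v ^ (s - 1)) ^ (r - k) * (v ^ m)⁻¹ =
      v ^ (((r - k : ℕ) : ℂ) * s - m - 1) := by
  have h1 : (v ^ (s - 1)) ^ (r - k) = v ^ (((r - k : ℕ) : ℂ) * (s - 1)) := (cpow_nat_mul _ _ _).symm
  rw [h1, ← cpow_natCast, ← cpow_natCast, ← cpow_neg, ← cpow_add _ _ hv, ← cpow_add _ _ hv]
  congr 1
  rw [show r - 1 - k = r - k - 1 by omega, Nat.cast_sub (by omega : 1 ≤ r - k)]
  push_cast
  ring

namespace Piece

variable {N n r : ℕ}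

/-- The piece of the matrix `a` given by a set `S` of coordinates in `(1, ∞)` and an
enumeration of the others. -/
def ofMatrix (a : Fin N → Fin n → ℂ) (S : Finset (Fin n)) (e : Fin r ≃ {j // j ∉ S})
    (κ : {i // ¬ ∃ j ∈ S, a i j ≠ 0} → Fin r) :
    Piece {j // j ∈ S} {i // ∃ j ∈ S, a i j ≠ 0} {i // ¬ ∃ j ∈ S, a i j ≠ 0} r where
  p i α := a i α
  x i k := a i (e k)
  c q k := a q (e k)
  κ := κ

variable {a : Fin N → Fin n → ℂ} {S : Finset (Fin n)} {e : Fin r ≃ {j // j ∉ S}}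

theorem exists_valid_ofMatrix (hH : HypH a) (hsmall : ∀ i, ∑ j, ‖a i j‖ < 1)
    (S : Finset (Fin n)) (e : Fin r ≃ {j // j ∉ S}) :
    ∃ κ c₀, (ofMatrix a S e κ).Valid c₀ := by
  obtain ⟨c₀, hc₀, hc⟩ := hH.exists_lower
  have key : ∀ q : {i // ¬ ∃ j ∈ S, a i j ≠ 0}, ∃ k : Fin r, a q (e k) ≠ 0 ∧
      ∀ k' < k, a q (e k') = 0 := by
    intro q
    obtain ⟨j, hj⟩ := hH.2 q
    have hjS : j ∉ S := fun h => q.2 ⟨j, h, hj⟩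
    have hne : {k : Fin r | a q (e k) ≠ 0}.Nonempty := ⟨e.symm ⟨j, hjS⟩, by simpa using hj⟩
    refine ⟨wellFounded_lt.min _ hne, wellFounded_lt.min_mem _ hne, fun k' hk' => ?_⟩
    by_contra h
    exact wellFounded_lt.not_lt_min _ h hk'
  choose κ hκ hκ0 using key
  refine ⟨κ, c₀, hc₀, fun i α => hH.re_nonneg _ _, fun i => ?_, fun i k => hH.re_nonneg _ _,
    fun q k => hH.re_nonneg _ _, fun q => hc _ _ (hκ q), hκ0, fun q => ?_⟩
  · obtain ⟨j, hj, h⟩ := i.2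
    exact ⟨⟨j, hj⟩, hc _ _ h⟩
  · refine lt_of_le_of_lt ?_ (hsmall q)
    rw [sum_eq_sum_add_sum_equiv e]
    exact le_add_of_nonneg_left (Finset.sum_nonneg fun _ _ => norm_nonneg _)

theorem mellinIntegrand_pieceMap {T : Type*} [MeasurableSpace T] {ν : Measure T} {τ : T → ℝ}
    {Λ b : ℂ → ℂ} (h : LaplaceKernel ν τ Λ b)
    {κ : {i // ¬ ∃ j ∈ S, a i j ≠ 0} → Fin r} {c₀ : ℝ} (hv : (ofMatrix a S e κ).Valid c₀)
    (w : Fin n → ℂ) (s : ℂ) (p : {j // j ∈ S} → ℝ) {v : Fin r → ℝ}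
    (hv01 : ∀ k, v k ∈ Set.Ioc (0 : ℝ) 1) :
    (∏ k : Fin r, (v k : ℂ) ^ (r - 1 - (k : ℕ))) *
        mellinIntegrand a w Λ s (pieceMap S e (p, v)) =
      (∏ k, (v k : ℂ) ^ (((r - k : ℕ) : ℂ) * s -
        (Finset.univ.filter fun q => k ≤ κ q).card - 1)) *
      (ofMatrix a S e κ).integrand Λ b (fun α => w α) (fun k => w (e k)) s p
        fun k => (v k : ℂ) := by
  set D := ofMatrix a S e κ
  set u : Fin r → ℂ := fun k => (v k : ℂ) with hu
  have hgood : D.Good c₀ u := hv.good_ofReal fun k => ⟨(hv01 k).1.le, (hv01 k).2⟩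
  have hS : ∀ α : {j // j ∈ S}, pieceMap S e (p, v) α = p α := fun α => by simp [pieceMap]
  have hE : ∀ k, pieceMap S e (p, v) (e k) = cumProd v k := fun k => by
    simp [pieceMap, (e k).2]
  have hrow : ∀ c : Fin n → ℂ, ∑ j, c j * (pieceMap S e (p, v) j : ℂ) =
      ∑ α : {j // j ∈ S}, c α * p α + ∑ k, c (e k) * cumProd u k := fun c => by
    rw [sum_eq_sum_add_sum_equiv e]
    simp only [hS, hE, ofReal_cumProd, hu]
  have hQ : ∀ q : {i // ¬ ∃ j ∈ S, a i j ≠ 0},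
      Λ (∑ j, a q j * (pieceMap S e (p, v) j : ℂ)) =
        (cumProd u (κ q))⁻¹ * (b (D.form q u) * (D.quot q u)⁻¹) := by
    intro q
    have e0 : ∑ j, a q j * (pieceMap S e (p, v) j : ℂ) = D.form q u := by
      rw [hrow, hv.form_eq, Finset.sum_eq_zero, zero_add]
      · rfl
      · intro α _
        have : a q α = 0 := by
          by_contra hne
          exact q.2 ⟨α, α.2, hne⟩
        rw [this, zero_mul]
    have hre : 0 < (D.form q u).re := by
      rw [form, show cumProd u (D.κ q) = ((cumProd v (D.κ q) : ℝ) : ℂ) from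
        (ofReal_cumProd _ _).symm, re_ofReal_mul]
      exact mul_pos (cumProd_mem_Ioc hv01 _).1 ((half_pos hv.pos).trans (hgood.quot_re q))
    rw [e0, h.eq_b _ hre (by simpa using (hgood.form_norm q).trans one_lt_two)]
    rw [show (D.form q u)⁻¹ = (cumProd u (κ q))⁻¹ * (D.quot q u)⁻¹ from mul_inv _ _]
    ring
  have hmono : (∏ k : Fin r, (v k : ℂ) ^ (r - 1 - (k : ℕ))) *
      (∏ k, ((cumProd v k : ℝ) : ℂ) ^ (s - 1)) * (∏ q, (cumProd u (κ q))⁻¹) =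
      ∏ k, (v k : ℂ) ^ (((r - k : ℕ) : ℂ) * s -
        (Finset.univ.filter fun q => k ≤ κ q).card - 1) := by
    rw [prod_cumProd_cpow fun k => (hv01 k).1, Finset.prod_inv_distrib, prod_cumProd_comp,
      ← Finset.prod_inv_distrib, ← Finset.prod_mul_distrib, ← Finset.prod_mul_distrib]
    exact Finset.prod_congr rfl fun k _ =>
      cpow_monomial (ofReal_ne_zero.2 (hv01 k).1.ne') k.2 s
  rw [← hmono, mellinIntegrand, integrand, prod_eq_prod_mul_prod_equiv e, hrow,
    ← Fintype.prod_subtype_mul_prod_subtype (fun i => ∃ j ∈ S, a i j ≠ 0)]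
  simp only [hQ, hS, hE, Finset.prod_mul_distrib]
  simp only [hrow]
  rw [neg_add, ← sub_eq_add_neg]
  simp only [D, ofMatrix]
  ring

end Piece

namespace Nice

variable {σ : Type*} {K : Subfield ℂ} {V : Set ℂ} {r : ℕ}

theorem prod_ite (p : Fin r → Prop) [DecidablePred p] :
    Nice K V r fun (_ : σ → ℂ) u => ∏ i, if p i then u i else 1 := by
  refine prod _ fun i _ => ?_
  by_cases h : p i
  · simpa only [h, if_true] using var i
  · simpa only [h, if_false] using const K.one_mem

theorem quot {A R Q : Type} {D : Piece A R Q r} (hc : ∀ q k, D.c q k ∈ K) (q : Q) :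
    Nice K V r fun (_ : σ → ℂ) u => D.quot q u :=
  sum _ fun k _ => (const (hc q k)).mul (prod_ite _)

theorem form {A R Q : Type} {D : Piece A R Q r} (hc : ∀ q k, D.c q k ∈ K) (q : Q) :
    Nice K V r fun (_ : σ → ℂ) u => D.form q u :=
  (prod_ite _).mul (quot hc q)

end Nice

theorem cumProd_zero {r : ℕ} (k : Fin r) : cumProd (0 : Fin r → ℂ) k = 0 :=
  Finset.prod_eq_zero (Finset.mem_univ k) (by simp)

theorem iteratedDeriv_inv_mem {K : Subfield ℂ} {c : ℂ} (hc : c ∈ K) (j : ℕ) :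
    iteratedDeriv j (fun z : ℂ => z⁻¹) c ∈ K := by
  rw [iteratedDeriv_eq_iterate, show (fun z : ℂ => z⁻¹) = Inv.inv from rfl, iter_deriv_inv]
  refine K.mul_mem (K.mul_mem (K.pow_mem (K.neg_mem K.one_mem) _) (natCast_mem K _))
    (zpow_mem hc _)

namespace Piece

variable {A R Q : Type} {r : ℕ} [Fintype A] [Fintype R] [Fintype Q]
  {T : Type*} [MeasurableSpace T] {ν : Measure T} {τ : T → ℝ} {Λ b : ℂ → ℂ}
  {D : Piece A R Q r} {c₀ : ℝ}

theorem Valid.quot_zero {A R Q : Type} {r : ℕ} {D : Piece A R Q r} {c₀ : ℝ} (hv : D.Valid c₀)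
    (q : Q) : D.quot q 0 = D.c q (D.κ q) := by
  rw [quot, Finset.sum_eq_single (D.κ q)]
  · rw [tailProd, Finset.prod_eq_one, mul_one]
    exact fun i _ => if_neg fun h => absurd h.1 (not_lt.2 h.2)
  · intro k _ hk
    rcases lt_or_gt_of_ne hk with h | h
    · rw [hv.c_zero q k h, zero_mul]
    · rw [tailProd, Finset.prod_eq_zero (Finset.mem_univ k) (by simp [h]), mul_zero]
  · simp

theorem fiber_of_isEmpty [IsEmpty A] [IsEmpty R] (wA : A → ℂ) (wR : Fin r → ℂ) (s : ℂ)
    (u : Fin r → ℂ) : D.fiber Λ b wA wR s u =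
      cexp (∑ k, -1 * (wR k * cumProd u k)) * ∏ q, b (D.form q u) * (D.quot q u)⁻¹ := by
  rw [fiber, Measure.pi_of_empty (fun _ : A => tailMeasure) isEmptyElim, integral_dirac, integrand]
  simp

theorem nice_fiber {A R Q : Type} {r : ℕ} [Fintype Q] {D : Piece A R Q r} {c₀ : ℝ} {σ : Type*}
    {K : Subfield ℂ}
    (h : LaplaceKernel ν τ Λ b) (hv : D.Valid c₀) (hc : ∀ q k, D.c q k ∈ K) {V : Set ℂ}
    (hV : ∀ u, (∀ k, u k ∈ V) → D.Good c₀ u) (α : Fin r → σ) :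
    Nice K V r fun (w : σ → ℂ) u =>
      cexp (∑ k, -1 * (w (α k) * cumProd u k)) * ∏ q, b (D.form q u) * (D.quot q u)⁻¹ := by
  refine .mul (.comp (c := 0) isOpen_univ differentiable_exp.differentiableOn trivial
    (fun j => ?_) (.sum _ fun k _ => .mul (.const (K.neg_mem K.one_mem))
      (.mul (.param (.var _)) (.prod_ite _))) (fun _ _ _ => trivial) fun w => ?_)
    (.prod _ fun q _ => .mul (.comp (c := 0) Metric.isOpen_ball h.hol_b (by simp) (fun j => ?_)
      (.form hc q) (fun w u hu => ?_) fun w => ?_)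
      (.comp (φ := fun z => z⁻¹) (c := D.c q (D.κ q)) isOpen_re_pos
        (differentiableOn_id.inv ?_) (hv.pos.trans_le (hv.c_big q))
        (iteratedDeriv_inv_mem (hc q _)) (.quot hc q) (fun w u hu => ?_)
        fun w => hv.quot_zero q))
  · rw [iteratedDeriv_eq_iterate, iter_deriv_exp, exp_zero]
    exact K.one_mem
  · simp [cumProd_zero]
  · obtain ⟨x, hx⟩ := h.rat_b j
    rw [hx]
    exact SubfieldClass.ratCast_mem K x
  · simpa using ((hV u hu).form_norm q).trans one_lt_two
  · simp [form, cumProd_zero]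
  · rintro z hz rfl
    simp at hz
  · exact (half_pos hv.pos).trans ((hV u hu).quot_re q)

end Piece

/-- A bounded convex neighbourhood of `-l` reaching the half-plane of convergence. -/
def contDomain (N n l : ℕ) : Set ℂ :=
  {s | -(l : ℝ) - 1 / (2 * n) < s.re} ∩ Metric.ball 0 (2 * N + l + 3)

theorem isOpen_contDomain (N n l : ℕ) : IsOpen (contDomain N n l) :=
  (isOpen_lt continuous_const continuous_re).inter Metric.isOpen_ball

theorem neg_natCast_mem_contDomain {N n : ℕ} (hn : 0 < n) (l : ℕ) :
    (-(l : ℂ)) ∈ contDomain N n l := by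
  refine ⟨?_, ?_⟩
  · have : (0 : ℝ) < 1 / (2 * n) := by positivity
    simpa using this
  · simp only [Metric.mem_ball, dist_zero_right, norm_neg, norm_natCast]
    have h0 : (0 : ℝ) ≤ N := N.cast_nonneg
    linarith

theorem ofReal_mem_contDomain {N n l : ℕ} {σ : ℝ} (hσ : σ ∈ Set.Ioo (2 * N : ℝ) (2 * N + 1)) :
    (σ : ℂ) ∈ contDomain N n l := by
  have h0 : (0 : ℝ) ≤ N := N.cast_nonneg
  have h1 : (0 : ℝ) ≤ l := l.cast_nonneg
  have h2 : (0 : ℝ) ≤ 1 / (2 * n) := by positivity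
  obtain ⟨h3, h4⟩ := hσ
  refine ⟨?_, ?_⟩
  · simp only [Set.mem_ofPred_eq, ofReal_re]
    linarith
  · simp only [Metric.mem_ball, dist_zero_right, norm_real, Real.norm_eq_abs]
    rw [abs_of_nonneg (by linarith)]
    linarith

theorem exists_piece_continuation {T : Type*} [MeasurableSpace T] {ν : Measure T} {τ : T → ℝ}
    {Λ b : ℂ → ℂ} (h : LaplaceKernel ν τ Λ b) {N n r : ℕ} (hn : 0 < n) {a : Fin N → Fin n → ℂ}
    (hH : HypH a) (hsmall : ∀ i, ∑ j, ‖a i j‖ < 1) {K : Subfield ℂ} (hK : ∀ i j, a i j ∈ K)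
    (l : ℕ) (S : Finset (Fin n)) (e : Fin r ≃ {j // j ∉ S}) :
    ∃ m : Fin r → ℕ, ∃ P, PolyFun K P ∧ ∀ w : Fin n → ℂ, (∀ j, 0 < (w j).re) →
      ∃ E : ℂ → ℂ, DifferentiableOn ℂ E (contDomain N n l) ∧ (S = ∅ → E (-(l : ℂ)) = P w) ∧
      ∀ σ ∈ Set.Ioo (2 * N : ℝ) (2 * N + 1),
        Integrable (fun q => (∏ k : Fin r, (q.2 k : ℂ) ^ (r - 1 - (k : ℕ))) *
          mellinIntegrand a w Λ σ (pieceMap S e q)) (pieceMeasure S r) →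
        ∫ q, (∏ k : Fin r, (q.2 k : ℂ) ^ (r - 1 - (k : ℕ))) *
          mellinIntegrand a w Λ σ (pieceMap S e q) ∂(pieceMeasure S r) =
        E σ / ∏ k : Fin r, ∏ j ∈ Finset.range ((r - k) * l + m k + 1),
          (((r - k : ℕ) : ℂ) * σ - m k + j) := by
  obtain ⟨κ, c₀, hv⟩ := Piece.exists_valid_ofMatrix hH hsmall S e
  set D := Piece.ofMatrix a S e κ with hD
  obtain ⟨V, ρ, hV, hVg⟩ := hv.exists_nhd
  set m : Fin r → ℕ := fun k => (Finset.univ.filter fun q => k ≤ κ q).card with hm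
  have hmN : ∀ k, m k ≤ N := fun k =>
    (Finset.card_le_univ _).trans ((Fintype.card_subtype_le _).trans (Fintype.card_fin N).le)
  have hrn : r ≤ n := by
    have := Fintype.card_congr e
    rw [Fintype.card_fin] at this
    rw [this]
    exact (Fintype.card_subtype_le _).trans (Fintype.card_fin n).le
  set A : Fin r → ℕ := fun k => (r - k) * l + m k with hA
  set z : ℂ → Fin r → ℂ := fun s k => ((r - k : ℕ) : ℂ) * s - m k with hz
  have hP : ∃ P, PolyFun K P ∧ (S = ∅ → ∀ w : Fin n → ℂ,
      mellinFold r A (z (-(l : ℂ))) (D.fiber Λ b (fun α => w α) (fun k => w (e k)) (-(l : ℂ))) =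
        P w) := by
    by_cases hS : S = ∅
    · have : IsEmpty {j // j ∈ S} := ⟨fun j => by simpa [hS] using j.2⟩
      have : IsEmpty {i // ∃ j ∈ S, a i j ≠ 0} := ⟨fun i => by simpa [hS] using i.2⟩
      refine ⟨_, (Piece.nice_fiber h hv (fun q k => hK _ _) hVg
        fun k => (e k : Fin n)).polyFun_mellinFold hV A, fun _ w => ?_⟩
      have hzl : z (-(l : ℂ)) = fun k => -(A k : ℂ) := by
        funext k
        simp only [hz, hA]
        push_cast
        ring
      rw [hzl]
      exact mellinFold_congr hV _ _ fun u _ => Piece.fiber_of_isEmpty _ _ _ _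
    · exact ⟨_, .const K.zero_mem, fun h => absurd h hS⟩
  obtain ⟨P, hPK, hP⟩ := hP
  refine ⟨m, P, hPK, fun w hw => ?_⟩
  set f : ℂ → (Fin r → ℂ) → ℂ := D.fiber Λ b (fun α => w α) (fun k => w (e k)) with hf
  have hMpos : (0 : ℝ) < 2 * N + l + 3 := by positivity
  obtain ⟨B, hB⟩ := Piece.exists_holB_fiber (D := D) (wR := fun k => w (e k)) h hv
    (wA := fun α => w α) (fun α => hw α) hMpos hV.isOpen hVg (isOpen_contDomain N n l) fun s hs =>
      (re_le_norm s).trans (mem_ball_zero_iff.1 hs.2).le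
  refine ⟨fun s => mellinFold r A (z s) (f s), ?_, fun hS => hP hS w, fun σ hσ hint => ?_⟩
  · refine hB.differentiableOn_mellinFold hV (isOpen_contDomain N n l) A z
      (n * (2 * N + l + 3) + N) (fun k => by fun_prop) (fun k s hs => ?_) fun k s hs => ?_
    · refine (norm_sub_le _ _).trans (add_le_add ?_ ?_)
      · rw [norm_mul, norm_natCast]
        refine mul_le_mul ?_ (mem_ball_zero_iff.1 hs.2).le (norm_nonneg _) (Nat.cast_nonneg _)
        exact_mod_cast (Nat.sub_le _ _).trans hrn
      · rw [norm_natCast]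
        exact_mod_cast hmN k
    · have h1 : -(l : ℝ) - 1 / (2 * n) < s.re := hs.1
      have h2 : ((r - k : ℕ) : ℝ) ≤ n := by exact_mod_cast (Nat.sub_le _ _).trans hrn
      have h3 : (z s k).re + A k = ((r - k : ℕ) : ℝ) * (s.re + l) := by
        simp only [hz, hA]
        rw [sub_re, ← ofReal_natCast, re_ofReal_mul, natCast_re]
        push_cast
        ring
      have hn' : (0 : ℝ) < n := by exact_mod_cast hn
      rw [h3]
      have h4 : -(1 / (2 * n) : ℝ) ≤ s.re + l := by linarith
      have h5 : ((r - k : ℕ) : ℝ) * -(1 / (2 * n) : ℝ) ≤ ((r - k : ℕ) : ℝ) * (s.re + l) :=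
        mul_le_mul_of_nonneg_left h4 (Nat.cast_nonneg _)
      refine le_trans ?_ h5
      rw [mul_neg, neg_le_neg_iff]
      calc ((r - k : ℕ) : ℝ) * (1 / (2 * n)) ≤ n * (1 / (2 * n)) :=
            mul_le_mul_of_nonneg_right h2 (by positivity)
        _ = 1 / 2 := by field_simp
  · have hzre : ∀ k, 0 < (z σ k).re := fun k => by
      have h1 : (1 : ℝ) ≤ ((r - k : ℕ) : ℝ) := by
        exact_mod_cast Nat.le_sub_of_add_le (by have := k.2; omega)
      have h2 : (m k : ℝ) ≤ N := by exact_mod_cast hmN k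
      have h3 : (z σ k).re = ((r - k : ℕ) : ℝ) * σ - m k := by
        simp only [hz]
        rw [sub_re, ← ofReal_natCast, re_ofReal_mul, natCast_re, ofReal_re]
      have h0 : (0 : ℝ) ≤ N := N.cast_nonneg
      have h4 : 1 * σ ≤ ((r - k : ℕ) : ℝ) * σ :=
        mul_le_mul_of_nonneg_right h1 (by linarith [hσ.1])
      rw [h3]
      linarith [hσ.1]
    have hae1 : ∀ᵐ q ∂(pieceMeasure S r), ∀ α, 1 < q.1 α :=
      Measure.quasiMeasurePreserving_fst.ae ae_pi_tailMeasure_mem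
    have hae2 : ∀ᵐ q ∂(pieceMeasure S r), ∀ k, q.2 k ∈ Set.Ioc (0 : ℝ) 1 :=
      Measure.quasiMeasurePreserving_snd.ae (ae_pi_unitMeasure_mem r)
    have hmeas : AEStronglyMeasurable (fun q : ({j // j ∈ S} → ℝ) × (Fin r → ℝ) =>
        D.integrand Λ b (fun α => w α) (fun k => w (e k)) σ q.1 fun k => (q.2 k : ℂ))
        (pieceMeasure S r) := by
      refine Piece.aestronglyMeasurable_integrand h hv measurable_fst (by fun_prop) hae1 ?_ _
      filter_upwards [hae2] with q hq
      exact hv.good_ofReal fun k => ⟨(hq k).1.le, (hq k).2⟩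
    have hfm : AEStronglyMeasurable (fun u : Fin r → ℝ => f σ fun k => (u k : ℂ))
        (Measure.pi fun _ => unitMeasure) :=
      hmeas.prod_swap.integral_prod_right'
    have hfold := mellinFold_eq_integral hV A hzre (hB.sep σ (ofReal_mem_contDomain hσ)) hfm
    have hne : (∏ k : Fin r, ∏ j ∈ Finset.range (A k + 1), (z σ k + j)) ≠ 0 := by
      refine Finset.prod_ne_zero_iff.2 fun k _ => Finset.prod_ne_zero_iff.2 fun j _ h0 => ?_
      have h1 := congrArg re h0
      rw [add_re, natCast_re, zero_re] at h1
      have := hzre k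
      have : (0 : ℝ) ≤ j := j.cast_nonneg
      linarith
    have hcong : (fun q : ({j // j ∈ S} → ℝ) × (Fin r → ℝ) =>
        (∏ k : Fin r, (q.2 k : ℂ) ^ (r - 1 - (k : ℕ))) *
          mellinIntegrand a w Λ σ (pieceMap S e q)) =ᵐ[pieceMeasure S r]
        fun q => (∏ k, (q.2 k : ℂ) ^ (z σ k - 1)) *
          D.integrand Λ b (fun α => w α) (fun k => w (e k)) σ q.1 fun k => (q.2 k : ℂ) := by
      filter_upwards [hae2] with q hq
      exact Piece.mellinIntegrand_pieceMap h hv w σ q.1 hq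
    rw [eq_div_iff hne, integral_congr_ae hcong, integral_prod_symm _ (hint.congr hcong), mul_comm]
    refine Eq.trans ?_ hfold.symm
    congr 2
    funext u
    exact integral_const_mul (∏ k, (u k : ℂ) ^ (z σ k - 1)) _

open Filter Topology in
theorem eq_of_frequently_eq_of_meromorphicOn {U : Set ℂ} (hU : IsPreconnected U) {F G : ℂ → ℂ}
    (hF : MeromorphicOn F U) (hG : MeromorphicOn G U) {x y : ℂ} (hx : x ∈ U) (hy : y ∈ U)
    (hxy : ∃ᶠ s in 𝓝[≠] x, F s = G s) (hFy : ContinuousAt F y) (hGy : ContinuousAt G y) :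
    F y = G y := by
  have hx0 : meromorphicOrderAt (F - G) x = ⊤ := by
    rw [meromorphicOrderAt_eq_top_iff]
    refine ((hF x hx).sub (hG x hx)).eventually_eq_zero_or_eventually_ne_zero.resolve_right
      fun h => hxy ?_
    filter_upwards [h] with s hs heq
    exact hs (sub_eq_zero.2 heq)
  have hy0 : meromorphicOrderAt (F - G) y = ⊤ := by
    by_contra hne
    exact (hF.sub hG).meromorphicOrderAt_ne_top_of_isPreconnected hU hy hx hne hx0
  have hev := meromorphicOrderAt_eq_top_iff.1 hy0
  have h1 : Tendsto (F - G) (𝓝[≠] y) (𝓝 ((F - G) y)) := (hFy.sub hGy).tendsto.mono_left inf_le_left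
  have h2 : Tendsto (F - G) (𝓝[≠] y) (𝓝 0) := tendsto_const_nhds.congr' (hev.mono fun _ h => h.symm)
  exact sub_eq_zero.1 (tendsto_nhds_unique h1 h2)

open Filter Topology in
theorem frequently_of_forall_ofReal_mem_Ioo {c d x : ℝ} (hx : x ∈ Set.Ioo c d) {p : ℂ → Prop}
    (h : ∀ σ ∈ Set.Ioo c d, p (σ : ℂ)) : ∃ᶠ s in 𝓝[≠] (x : ℂ), p s := by
  have h1 : Tendsto (fun σ : ℝ => (σ : ℂ)) (𝓝[≠] x) (𝓝[≠] (x : ℂ)) :=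
    tendsto_nhdsWithin_iff.2 ⟨(continuous_ofReal.tendsto x).mono_left inf_le_left,
      eventually_nhdsWithin_of_forall fun σ hσ => by simpa using hσ⟩
  refine h1.frequently (Eventually.frequently ?_)
  filter_upwards [nhdsWithin_le_nhds (Ioo_mem_nhds hx.1 hx.2)] with σ hσ
  exact h σ hσ

theorem isPreconnected_contDomain (N n l : ℕ) : IsPreconnected (contDomain N n l) :=
  ((convex_halfSpace_re_gt _).inter (convex_ball _ _)).isPreconnected

/-- The entire function `(Γ s)⁻¹ / (s + l)`. -/
def invGammaQuot (l : ℕ) (s : ℂ) : ℂ :=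
  (∏ j ∈ Finset.range l, (s + j)) * (Gamma (s + l + 1))⁻¹

theorem inv_Gamma_eq_mul_invGammaQuot (l : ℕ) (s : ℂ) :
    (Gamma s)⁻¹ = (s + l) * invGammaQuot l s := by
  induction l with
  | zero => simpa [invGammaQuot] using one_div_Gamma_eq_self_mul_one_div_Gamma_add_one s
  | succ l ih =>
    rw [ih, invGammaQuot, invGammaQuot, Finset.prod_range_succ,
      one_div_Gamma_eq_self_mul_one_div_Gamma_add_one (s + l + 1)]
    push_cast
    rw [show s + (l + 1 : ℂ) + 1 = s + l + 1 + 1 by ring]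
    ring

theorem differentiable_invGammaQuot (l : ℕ) : Differentiable ℂ (invGammaQuot l) := by
  refine Differentiable.fun_mul (Differentiable.fun_finsetProd fun j _ => by fun_prop) ?_
  exact differentiable_one_div_Gamma.comp (f := fun s : ℂ => s + l + 1) (by fun_prop)

theorem invGammaQuot_neg_mem (K : Subfield ℂ) (l : ℕ) : invGammaQuot l (-(l : ℂ)) ∈ K := by
  rw [invGammaQuot, neg_add_cancel, zero_add, Gamma_one, inv_one, mul_one]
  exact K.prod_mem fun j _ => K.add_mem (K.neg_mem (natCast_mem K l)) (natCast_mem K j)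

/-- The factors of the denominator of a piece which do not vanish at `-l`. -/
def denQuot {r : ℕ} (l : ℕ) (m : Fin r → ℕ) (s : ℂ) : ℂ :=
  (∏ k : Fin r, ((r - k : ℕ) : ℂ)) *
    ∏ k : Fin r, ∏ j ∈ Finset.range ((r - k) * l + m k), (((r - k : ℕ) : ℂ) * s - m k + j)

theorem prod_prod_range_eq {r : ℕ} (l : ℕ) (m : Fin r → ℕ) (s : ℂ) :
    ∏ k : Fin r, ∏ j ∈ Finset.range ((r - k) * l + m k + 1), (((r - k : ℕ) : ℂ) * s - m k + j) =
      (s + l) ^ r * denQuot l m s := by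
  have h : ∀ k : Fin r, ((r - k : ℕ) : ℂ) * s - m k + ((r - k) * l + m k : ℕ) =
      (s + l) * ((r - k : ℕ) : ℂ) := fun k => by
    push_cast
    ring
  simp only [Finset.prod_range_succ, h, Finset.prod_mul_distrib, Finset.prod_const,
    Finset.card_univ, Fintype.card_fin, denQuot]
  ring

theorem differentiable_denQuot {r : ℕ} (l : ℕ) (m : Fin r → ℕ) :
    Differentiable ℂ (denQuot l m) :=
  (differentiable_const _).fun_mul (Differentiable.fun_finsetProd fun k _ =>
    Differentiable.fun_finsetProd fun j _ => by fun_prop)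

theorem denQuot_neg_ne_zero {r : ℕ} (l : ℕ) (m : Fin r → ℕ) : denQuot l m (-(l : ℂ)) ≠ 0 := by
  refine mul_ne_zero (Finset.prod_ne_zero_iff.2 fun k _ => ?_)
    (Finset.prod_ne_zero_iff.2 fun k _ => Finset.prod_ne_zero_iff.2 fun j hj h0 => ?_)
  · exact Nat.cast_ne_zero.2 (Nat.sub_ne_zero_of_lt k.2)
  · have h1 : (j : ℂ) = ((r - k) * l + m k : ℕ) := by
      push_cast
      linear_combination h0
    exact (Finset.mem_range.1 hj).ne (Nat.cast_injective h1)

theorem denQuot_neg_mem (K : Subfield ℂ) {r : ℕ} (l : ℕ) (m : Fin r → ℕ) :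
    denQuot l m (-(l : ℂ)) ∈ K :=
  K.mul_mem (K.prod_mem fun _ _ => natCast_mem K _) (K.prod_mem fun _ _ => K.prod_mem fun j _ =>
    K.add_mem (K.sub_mem (K.mul_mem (natCast_mem K _) (K.neg_mem (natCast_mem K l)))
      (natCast_mem K _)) (natCast_mem K j))

theorem MeromorphicOn.of_differentiable {f : ℂ → ℂ} (hf : Differentiable ℂ f) (U : Set ℂ) :
    MeromorphicOn f U := fun x _ => (hf.analyticAt x).meromorphicAt

theorem exists_polyFun_of_small {T : Type*} [MeasurableSpace T] {ν : Measure T} [SigmaFinite ν]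
    {τ : T → ℝ} {Λ b : ℂ → ℂ} (h : LaplaceKernel ν τ Λ b) {N n : ℕ} (hn : 0 < n)
    {a : Fin N → Fin n → ℂ} (hH : HypH a) (hsmall : ∀ i, ∑ j, ‖a i j‖ < 1) {K : Subfield ℂ}
    (hK : ∀ i j, a i j ∈ K) (l : ℕ) :
    ∃ P, PolyFun K P ∧ ∀ w : Fin n → ℂ, (∀ j, 0 < (w j).re) → ∀ F : ℂ → ℂ,
      (∀ σ ∈ Set.Ioo (2 * N : ℝ) (2 * N + 1), F σ =
        ∫ t, ∏ j, (linForm a w (fun i => τ (t i)) j) ^ (-(σ : ℂ))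
          ∂(Measure.pi fun _ : Fin N => ν)) →
      MeromorphicOn F Set.univ → AnalyticAt ℂ F (-(l : ℂ)) → F (-(l : ℂ)) = P w := by
  obtain ⟨ι, hι, S, r, e, hpieces⟩ := exists_pieces n
  choose m P hP hE using fun i => exists_piece_continuation h hn hH hsmall hK l (S i) (e i)
  have hrn : ∀ i, r i ≤ n := fun i => by
    have := Fintype.card_congr (e i)
    rw [Fintype.card_fin] at this
    rw [this]
    exact (Fintype.card_subtype_le _).trans (Fintype.card_fin n).le
  have hSr : ∀ i, r i = n → S i = ∅ := fun i hi => by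
    have h1 := Fintype.card_congr (e i)
    have h2 : Fintype.card {j // j ∉ S i} = n - (S i).card := by simp
    have h3 : (S i).card ≤ n := (Finset.card_le_univ _).trans (Fintype.card_fin n).le
    rw [Fintype.card_fin, hi, h2] at h1
    exact Finset.card_eq_zero.1 (by omega)
  set c : ι → ℂ := fun i =>
    0 ^ (n - r i) * invGammaQuot l (-(l : ℂ)) ^ n * (denQuot l (m i) (-(l : ℂ)))⁻¹ with hc
  refine ⟨fun w => ∑ i, c i * P i w, .sum _ fun i _ => .mul (.const ?_) (hP i),
    fun w hw F hF hmer han => ?_⟩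
  · exact K.mul_mem (K.mul_mem (K.pow_mem K.zero_mem _) (K.pow_mem (invGammaQuot_neg_mem K l) _))
      (K.inv_mem (denQuot_neg_mem K l _))
  choose E hEd hE0 hEσ using fun i => hE i w hw
  set U := contDomain N n l
  have hUo : IsOpen U := isOpen_contDomain N n l
  have hlU : -(l : ℂ) ∈ U := neg_natCast_mem_contDomain hn l
  set G : ℂ → ℂ := fun s => ∑ i, (s + l) ^ (n - r i) * invGammaQuot l s ^ n *
    (denQuot l (m i) s)⁻¹ * E i s with hG
  have hGm : MeromorphicOn G U := by
    refine MeromorphicOn.fun_sum fun i => MeromorphicOn.fun_mul (MeromorphicOn.fun_mul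
      (.of_differentiable ?_ _) (MeromorphicOn.fun_inv
        (.of_differentiable (differentiable_denQuot l _) _))) fun x hx => ?_
    · have := differentiable_invGammaQuot l
      fun_prop
    · exact ((hEd i).analyticAt (hUo.mem_nhds hx)).meromorphicAt
  have hGc : ContinuousAt G (-(l : ℂ)) := by
    refine tendsto_finsetSum _ fun i _ => ?_
    refine ContinuousAt.mul (ContinuousAt.mul ?_ ((differentiable_denQuot l
      (m i)).continuous.continuousAt.inv₀ (denQuot_neg_ne_zero l _)))
      ((hEd i).continuousOn.continuousAt (hUo.mem_nhds hlU))
    have := (differentiable_invGammaQuot l).continuous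
    fun_prop
  have hGl : G (-(l : ℂ)) = ∑ i, c i * P i w := by
    refine Finset.sum_congr rfl fun i _ => ?_
    rw [neg_add_cancel]
    by_cases hi : r i = n
    · rw [hE0 i (hSr i hi)]
    · have : n - r i ≠ 0 := by have := hrn i; omega
      simp [hc, this]
  refine Eq.trans ?_ hGl
  have hx : (2 * N + 1 / 2 : ℝ) ∈ Set.Ioo (2 * N : ℝ) (2 * N + 1) := ⟨by linarith, by linarith⟩
  refine eq_of_frequently_eq_of_meromorphicOn (isPreconnected_contDomain N n l)
    (hmer.mono_set (Set.subset_univ _)) hGm (ofReal_mem_contDomain hx) hlU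
    (frequently_of_forall_ofReal_mem_Ioo hx fun σ hσ => ?_) han.continuousAt hGc
  have hN0 : (0 : ℝ) ≤ 2 * N := by positivity
  have hσ0 : 0 < σ := hN0.trans_lt hσ.1
  obtain ⟨hint, hsum⟩ := hpieces
    (fun x => (∏ j, x j ^ ((σ : ℂ) - 1)) * cexp (-∑ j, w j * x j) * ∏ i, Λ (∑ j, a i j * x j))
    (h.integrable_mellinIntegrand hH hw hσ0 hσ.1.le)
  have hΓ : Gamma σ ≠ 0 := Gamma_ne_zero_of_re_pos (by simpa using hσ0)
  have hσl : (σ : ℂ) + l ≠ 0 := by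
    have h1 : 0 < σ + l := by positivity
    exact_mod_cast h1.ne'
  have h1 : Gamma σ ^ n * F σ = ∑ i, E i σ / ((σ + l) ^ r i * denQuot l (m i) σ) := by
    rw [hF σ hσ, ← h.integral_mellinIntegrand hH hw hσ0 hσ.1.le]
    refine hsum.trans (Finset.sum_congr rfl fun i _ => ?_)
    rw [← prod_prod_range_eq]
    exact hEσ i σ hσ (hint i)
  have h2 : F σ = (Gamma σ)⁻¹ ^ n * ∑ i, E i σ / ((σ + l) ^ r i * denQuot l (m i) σ) := by
    rw [← h1, inv_pow, inv_mul_cancel_left₀ (pow_ne_zero n hΓ)]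
  rw [h2, hG, Finset.mul_sum, inv_Gamma_eq_mul_invGammaQuot l]
  refine Finset.sum_congr rfl fun i _ => ?_
  rw [mul_pow, ← pow_sub_mul_pow _ (hrn i), div_eq_mul_inv, mul_inv]
  have h3 : ((σ : ℂ) + l) ^ r i ≠ 0 := pow_ne_zero _ hσl
  field_simp

theorem real_mul_cpow {r : ℝ} (hr : 0 < r) {x : ℂ} (hx : x ≠ 0) (s : ℂ) :
    ((r : ℂ) * x) ^ s = cexp (Real.log r * s) * x ^ s := by
  have hr' : (r : ℂ) ≠ 0 := by exact_mod_cast hr.ne'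
  rw [cpow_def_of_ne_zero (mul_ne_zero hr' hx), cpow_def_of_ne_zero hx, log_ofReal_mul hr hx,
    add_mul, Complex.exp_add]

theorem exists_polyFun {N n : ℕ} {a : Fin N → Fin n → ℂ} {T : Type*} [MeasurableSpace T]
    {ν : Measure T} {τ : T → ℝ} {Λ b : ℂ → ℂ} [SigmaFinite ν] (h : LaplaceKernel ν τ Λ b)
    (hn : 0 < n) (hH : HypH a) {K : Subfield ℂ} (hK : ∀ i j, a i j ∈ K) (l : ℕ) :
    ∃ P, PolyFun K P ∧ ∀ w : Fin n → ℂ, (∀ j, 0 < (w j).re) → ∀ F : ℂ → ℂ,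
      (∀ σ ∈ Set.Ioo (2 * N : ℝ) (2 * N + 1), F σ = ∫ t, ∏ j,
        (linForm a w (fun i => τ (t i)) j) ^ (-(σ : ℂ)) ∂(Measure.pi fun _ : Fin N => ν)) →
      MeromorphicOn F Set.univ → AnalyticAt ℂ F (-(l : ℂ)) → F (-(l : ℂ)) = P w := by
  obtain ⟨m, hm⟩ := exists_nat_gt (∑ i, ∑ j, ‖a i j‖)
  have hm0 : (0 : ℝ) < m := lt_of_le_of_lt (by positivity) hm
  set r : ℝ := (m : ℝ)⁻¹ with hr
  have hr0 : 0 < r := inv_pos.2 hm0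
  have hrC : (r : ℂ) ≠ 0 := by exact_mod_cast hr0.ne'
  have hrK : (r : ℂ) ∈ K := by
    rw [hr]; push_cast; exact K.inv_mem (natCast_mem K m)
  have hH' : HypH fun i j => (r : ℂ) * a i j := by
    refine ⟨fun i j => (hH.1 i j).imp (fun h0 => by simp [h0]) fun h0 => ?_, fun i => ?_⟩
    · rw [re_ofReal_mul]; exact mul_pos hr0 h0
    · obtain ⟨j, hj⟩ := hH.2 i
      exact ⟨j, mul_ne_zero hrC hj⟩
  have hsmall : ∀ i, ∑ j, ‖(r : ℂ) * a i j‖ < 1 := fun i => by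
    simp_rw [norm_mul, ← Finset.mul_sum, norm_real, Real.norm_of_nonneg hr0.le, hr]
    rw [inv_mul_lt_one₀ hm0]
    exact (Finset.single_le_sum (f := fun i => ∑ j, ‖a i j‖) (fun _ _ => by positivity)
      (Finset.mem_univ i)).trans_lt hm
  obtain ⟨P, hP, hPF⟩ := exists_polyFun_of_small h hn hH' hsmall
    (fun i j => K.mul_mem hrK (hK i j)) l
  refine ⟨fun w => ((r : ℂ) ^ (l * n))⁻¹ * P fun j => r * w j,
    .mul (.const (K.inv_mem (K.pow_mem hrK _))) (hP.smul_comp hrK), fun w hw F hF hmer han => ?_⟩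
  have hE : Differentiable ℂ fun s : ℂ => cexp (Real.log r * -s) ^ n := by fun_prop
  have hlin : ∀ t j, linForm (fun i j => (r : ℂ) * a i j) (fun j => r * w j) t j =
      r * linForm a w t j := fun t j => by
    simp only [linForm, mul_add, Finset.mul_sum]
    congr 1
    exact Finset.sum_congr rfl fun i _ => by ring
  have key := hPF (fun j => r * w j) (fun j => by
      rw [re_ofReal_mul]; exact mul_pos hr0 (hw j)) (fun s => cexp (Real.log r * -s) ^ n * F s)
    (fun σ hσ => by
      rw [hF σ hσ, ← integral_const_mul]
      refine integral_congr_ae (.of_forall fun t => ?_)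
      have h0 : ∀ j, linForm a w (fun i => τ (t i)) j ≠ 0 := fun j h0 => by
        have := linForm_re_pos hH hw (t := fun i => τ (t i)) (fun i => h.nonneg _) j
        simp [h0] at this
      simp only [hlin, real_mul_cpow hr0 (h0 _), Finset.prod_mul_distrib, Finset.prod_const,
        Finset.card_univ, Fintype.card_fin])
    (MeromorphicOn.fun_mul (.of_differentiable hE _) hmer) (hE.analyticAt _ |>.fun_mul han)
  have he : cexp (Real.log r * -(-(l : ℂ))) ^ n = (r : ℂ) ^ (l * n) := by
    rw [neg_neg, pow_mul, mul_comm, Complex.exp_nat_mul, ← ofReal_exp, Real.exp_log hr0]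
  simp only [he] at key
  beta_reduce
  rw [← key, inv_mul_cancel_left₀ (pow_ne_zero _ hrC)]

theorem laplaceKernel_half :
    LaplaceKernel (volume.restrict (Set.Ioi (0 : ℝ))) (fun t => |t|) (fun z => z⁻¹) 1 where
  measurable := by fun_prop
  nonneg t := abs_nonneg t
  integrable := by
    have h := integrable_inv_one_add_sq.restrict (s := Set.Ioi (0 : ℝ))
    refine h.mono' (by fun_prop) (.of_forall fun t => ?_)
    rw [norm_inv, Real.norm_of_nonneg (by positivity)]
    refine inv_anti₀ (by positivity) ?_
    have := abs_nonneg t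
    nlinarith [sq_abs t]
  laplace z hz := by
    have h := integral_exp_mul_complex_Ioi (a := -z) (by simpa using hz) 0
    rw [show (z⁻¹ : ℂ) = -cexp (-z * (0 : ℝ)) / -z by simp [neg_div_neg_eq], ← h]
    refine setIntegral_congr_fun measurableSet_Ioi fun t ht => ?_
    simp only [abs_of_pos (Set.mem_Ioi.1 ht)]
    congr 1; ring
  hol := differentiableOn_inv.mono fun z hz h0 => by simp_all
  bound c hc := ⟨c⁻¹, fun z hz => by
    rw [norm_inv]
    exact inv_anti₀ hc (hz.trans (re_le_norm z))⟩
  hol_b := differentiableOn_const _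
  eq_b z _ _ := by simp
  rat_b j := by
    refine ⟨if j = 0 then 1 else 0, ?_⟩
    rw [show (1 : ℂ → ℂ) = fun _ => 1 from rfl, iteratedDeriv_const]
    split_ifs <;> simp

/-- The entire function `(1 - exp (-z)) / z`. -/
def expQuot : ℂ → ℂ := dslope (fun z => 1 - cexp (-z)) 0

theorem mul_expQuot (z : ℂ) : z * expQuot z = 1 - cexp (-z) := by
  have := sub_smul_dslope (fun z => 1 - cexp (-z)) 0 z
  simpa [expQuot] using this

theorem expQuot_zero : expQuot 0 = 1 := by
  have h : HasDerivAt (fun z : ℂ => 1 - cexp (-z)) (-(cexp (-0) * -1)) 0 :=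
    ((hasDerivAt_neg (0 : ℂ)).cexp).const_sub 1
  rw [expQuot, dslope_same, h.deriv]
  simp

theorem differentiable_expQuot : Differentiable ℂ expQuot := by
  rw [← differentiableOn_univ, expQuot, differentiableOn_dslope Filter.univ_mem,
    differentiableOn_univ]
  fun_prop

theorem one_sub_exp_neg_ne_zero {z : ℂ} (hz : 0 < z.re) : 1 - cexp (-z) ≠ 0 := fun h => by
  have h1 : ‖cexp (-z)‖ = 1 := by rw [← sub_eq_zero.1 h, norm_one]
  rw [norm_exp, neg_re, Real.exp_eq_one_iff] at h1
  linarith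

theorem expQuot_ne_zero {z : ℂ} (hz : z ∈ Metric.ball (0 : ℂ) 2) : expQuot z ≠ 0 := fun h => by
  have h1 := mul_expQuot z
  rw [h, mul_zero, eq_comm, sub_eq_zero, eq_comm, Complex.exp_eq_one_iff] at h1
  obtain ⟨k, hk⟩ := h1
  have hk0 : k ≠ 0 := by
    rintro rfl
    have : z = 0 := by simpa using hk
    simp [this, expQuot_zero] at h
  have h2 : ‖z‖ = |(k : ℝ)| * (2 * Real.pi) := by
    rw [← norm_neg, hk]
    simp [abs_of_pos Real.pi_pos]
  have h3 : (1 : ℝ) ≤ |(k : ℝ)| := by exact_mod_cast Int.one_le_abs hk0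
  have h4 : ‖z‖ < 2 := by simpa using hz
  nlinarith [Real.pi_gt_three]

theorem iteratedDeriv_expQuot_mem (K : Subfield ℂ) (j : ℕ) : iteratedDeriv j expQuot 0 ∈ K := by
  have hd : ContDiff ℂ (j + 1 : ℕ) expQuot := differentiable_expQuot.contDiff
  have h1 : iteratedDeriv (j + 1) (fun z => z * expQuot z) 0 =
      (j + 1 : ℕ) * iteratedDeriv j expQuot 0 := by
    rw [iteratedDeriv_fun_mul contDiffAt_fun_id hd.contDiffAt, Finset.sum_eq_single 1]
    · simp
    · intro i _ hi
      simp [iteratedDeriv_fun_id, hi]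
    · simp
  have h2 : iteratedDeriv (j + 1) (fun z => z * expQuot z) 0 = -(-1) ^ (j + 1) := by
    simp_rw [mul_expQuot]
    rw [iteratedDeriv_const_sub (by omega)]
    have h := congrFun (iteratedDeriv_cexp_const_mul (j + 1) (-1)) 0
    simp only [neg_one_mul] at h
    rw [iteratedDeriv_neg, h]
    simp
  have h3 : ((j + 1 : ℕ) : ℂ) ≠ 0 := by exact_mod_cast (Nat.succ_ne_zero j)
  rw [show iteratedDeriv j expQuot 0 = ((j + 1 : ℕ) : ℂ)⁻¹ * -(-1) ^ (j + 1) by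
    rw [← h2, h1, inv_mul_cancel_left₀ h3]]
  exact K.mul_mem (K.inv_mem (natCast_mem K _))
    (K.neg_mem (K.pow_mem (K.neg_mem K.one_mem) _))

theorem iteratedDeriv_fun_inv_mem (K : Subfield ℂ) {g : ℂ → ℂ} {x : ℂ} (hg : AnalyticAt ℂ g x)
    (h0 : g x ≠ 0) (hK : ∀ j, iteratedDeriv j g x ∈ K) (j : ℕ) :
    iteratedDeriv j (fun z => (g z)⁻¹) x ∈ K := by
  induction j using Nat.strong_induction_on with
  | _ j ih =>
    have hgK : g x ∈ K := by simpa using hK 0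
    rcases Nat.eq_zero_or_pos j with rfl | hj
    · simpa using K.inv_mem hgK
    have h1 : iteratedDeriv j (fun z => (g z)⁻¹ * g z) x = 0 := by
      have he : (fun z => (g z)⁻¹ * g z) =ᶠ[nhds x] fun _ => (1 : ℂ) := by
        filter_upwards [hg.continuousAt.eventually_ne h0] with z hz
        exact inv_mul_cancel₀ hz
      rw [he.iteratedDeriv_eq, iteratedDeriv_const]
      simp [hj.ne']
    rw [iteratedDeriv_fun_mul (hg.fun_inv h0).contDiffAt hg.contDiffAt, Finset.sum_range_succ,
      Nat.choose_self, Nat.cast_one, one_mul, Nat.sub_self, iteratedDeriv_zero] at h1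
    rw [(eq_div_iff h0).2 (eq_neg_of_add_eq_zero_right h1)]
    exact K.div_mem (K.neg_mem (sum_mem fun i hi => K.mul_mem (K.mul_mem (natCast_mem K _)
      (ih i (Finset.mem_range.1 hi))) (hK _))) hgK

theorem laplaceKernel_nat :
    LaplaceKernel (Measure.count : Measure ℕ) (fun k => (k : ℝ))
      (fun z => (1 - cexp (-z))⁻¹) fun z => (expQuot z)⁻¹ where
  measurable := by fun_prop
  nonneg t := t.cast_nonneg
  integrable := by
    rw [integrable_count_iff]
    have := (summable_nat_add_iff 1).2 (Real.summable_nat_pow_inv.2 one_lt_two)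
    simpa [add_comm] using this
  laplace z hz := by
    have h1 : ‖cexp (-z)‖ < 1 := by
      rw [norm_exp, neg_re, Real.exp_lt_one_iff]; linarith
    have h2 : (fun t : ℕ => cexp (-(((t : ℝ) : ℂ) * z))) = fun t => cexp (-z) ^ t := by
      ext t
      rw [← Complex.exp_nat_mul]
      congr 1; push_cast; ring
    rw [h2, integral_countable (integrable_count_iff.2 (summable_geometric_of_norm_lt_one h1).norm)]
    simp [tsum_geometric_of_norm_lt_one h1]
  hol := DifferentiableOn.fun_inv (by fun_prop) fun z hz => one_sub_exp_neg_ne_zero hz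
  bound c hc := ⟨(1 - Real.exp (-c))⁻¹, fun z hz => by
    have h1 : Real.exp (-c) < 1 := by rw [Real.exp_lt_one_iff]; linarith
    rw [norm_inv]
    refine inv_anti₀ (by linarith) ?_
    have h2 := norm_sub_norm_le (1 : ℂ) (cexp (-z))
    have h3 : Real.exp (-z.re) ≤ Real.exp (-c) := Real.exp_le_exp.2 (by linarith)
    rw [norm_one, norm_exp, neg_re] at h2
    linarith⟩
  hol_b := differentiable_expQuot.differentiableOn.fun_inv fun z hz => expQuot_ne_zero hz
  eq_b z hz _ := by rw [← mul_expQuot, mul_inv_rev]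
  rat_b j := by
    obtain ⟨q, hq⟩ := iteratedDeriv_fun_inv_mem (Rat.castHom ℂ).fieldRange
      (differentiable_expQuot.analyticAt 0) (by simp [expQuot_zero])
      (iteratedDeriv_expQuot_mem _) j
    exact ⟨q, hq.symm⟩

theorem zetaSeries_eq_integral {N n : ℕ} {a : Fin N → Fin n → ℂ} (hH : HypH a) {w : Fin n → ℂ}
    (hw : ∀ j, 0 < (w j).re) {σ : ℝ} (hσ : 2 * N ≤ σ) :
    zetaSeries a σ w = ∫ t, ∏ j, (linForm a w (fun i => (t i : ℝ)) j) ^ (-(σ : ℂ))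
      ∂(Measure.pi fun _ : Fin N => (Measure.count : Measure ℕ)) := by
  rw [integral_countable (laplaceKernel_nat.integrable_prod_cpow hH hw hσ)]
  simp [zetaSeries, linForm, measureReal_def]

theorem zetaIntegral_eq_integral {N n : ℕ} (a : Fin N → Fin n → ℂ) (w : Fin n → ℂ) (σ : ℝ) :
    zetaIntegral a σ w = ∫ t, ∏ j, (linForm a w (fun i => |t i|) j) ^ (-(σ : ℂ))
      ∂(Measure.pi fun _ : Fin N => volume.restrict (Set.Ioi (0 : ℝ))) := by
  have h1 : {t : Fin N → ℝ | ∀ i, 0 < t i} = Set.univ.pi fun _ => Set.Ioi 0 := by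
    ext t; simp
  rw [zetaIntegral, h1, volume_pi, ← Measure.restrict_pi_pi]
  refine setIntegral_congr_fun (.univ_pi fun _ => measurableSet_Ioi) fun t ht => ?_
  have h2 : ∀ i, |t i| = t i := fun i => abs_of_pos (ht i trivial)
  simp only [linForm, h2]

/-- The special values `ζ_{N,n}(-ℓ,w,M)` and `𝒵_{N,n}(-ℓ,w,M)` are polynomial
functions of `w` with coefficients in the subfield of `ℂ` generated by the
entries of `M` (which contains `ℚ`). -/
theorem specialValues_are_polynomials {N n : ℕ} (hN : 0 < N) (hn : 0 < n)
    (a : Fin N → Fin n → ℂ) (hH : HypH a) (l : ℕ) :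
    ∃ p q : MvPolynomial (Fin n) ℂ,
      (∀ d, MvPolynomial.coeff d p ∈
        Subfield.closure (Set.range fun ij : Fin N × Fin n => a ij.1 ij.2)) ∧
      (∀ d, MvPolynomial.coeff d q ∈
        Subfield.closure (Set.range fun ij : Fin N × Fin n => a ij.1 ij.2)) ∧
      ∀ w : Fin n → ℂ, (∀ j, 0 < (w j).re) →
        (∀ F : ℂ → ℂ, (∀ s : ℂ, (N : ℝ) < s.re → F s = zetaSeries a s w) →
          MeromorphicOn F Set.univ → AnalyticAt ℂ F (-(l : ℂ)) →
          F (-(l : ℂ)) = MvPolynomial.eval w p) ∧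
        (∀ F : ℂ → ℂ, (∀ s : ℂ, (N : ℝ) < s.re → F s = zetaIntegral a s w) →
          MeromorphicOn F Set.univ → AnalyticAt ℂ F (-(l : ℂ)) →
          F (-(l : ℂ)) = MvPolynomial.eval w q) := by
  have hK : ∀ i j, a i j ∈ Subfield.closure (Set.range fun ij : Fin N × Fin n => a ij.1 ij.2) :=
    fun i j => Subfield.subset_closure ⟨(i, j), rfl⟩
  obtain ⟨P, hP, hPF⟩ := exists_polyFun laplaceKernel_nat hn hH hK l
  obtain ⟨Q, hQ, hQF⟩ := exists_polyFun laplaceKernel_half hn hH hK l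
  obtain ⟨p, hp, hPp⟩ := hP.exists_complex
  obtain ⟨q, hq, hQq⟩ := hQ.exists_complex
  have hre : ∀ σ ∈ Set.Ioo (2 * N : ℝ) (2 * N + 1), (N : ℝ) < (σ : ℂ).re := fun σ hσ => by
    have h0 : (0 : ℝ) < N := by exact_mod_cast hN
    rw [ofReal_re]
    linarith [hσ.1]
  refine ⟨p, q, hp, hq, fun w hw => ⟨fun F hF hmer han => ?_, fun F hF hmer han => ?_⟩⟩
  · rw [← hPp]
    refine hPF w hw F (fun σ hσ => ?_) hmer han
    rw [hF σ (hre σ hσ), zetaSeries_eq_integral hH hw hσ.1.le]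
  · rw [← hQq]
    refine hQF w hw F (fun σ hσ => ?_) hmer han
    rw [hF σ (hre σ hσ), zetaIntegral_eq_integral]
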